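/- arXiv:2302.05784 — 4 statements merged into one kernel-verified Lean document; each statement's English description precedes it below -/
import Mathlib

section
/- Let G be a finite nilpotent group of order n. Then the number of edges of the cyclic subgroup graph of G is at least the number of edges of the cyclic subgroup graph of the cyclic group ℤ_n, with equality if and only if G is cyclic. -/
def cyclicGraphEdges (G : Type*) [Group G] : Set (Subgroup G × Subgroup G) :=
  {e | IsCyclic e.1 ∧ IsCyclic e.2 ∧ e.1 < e.2 ∧
    ∀ K : Subgroup G, IsCyclic K → e.1 < K → ¬ K < e.2}

noncomputable def numCyclicEdges (G : Type*) [Group G] : ℕ :=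
  Nat.card (cyclicGraphEdges G)

def cyclicFlags (G : Type*) [Group G] : Set (Subgroup G × ℕ) :=
  {e | IsCyclic e.1 ∧ e.2.Prime ∧ e.2 ∣ Nat.card e.1}

theorem zpowers_pow_lt {G : Type*} [Group G] [Finite G] (g : G) (p : ℕ) (hp : p.Prime)
    (hd : p ∣ orderOf g) : Subgroup.zpowers (g ^ p) < Subgroup.zpowers g := by
  refine lt_of_le_of_ne ?_ ?_
  · rw [Subgroup.zpowers_le]
    exact Subgroup.npow_mem_zpowers g p
  · intro h
    have h1 := congrArg (fun H : Subgroup G => Nat.card H) h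
    simp only [Nat.card_zpowers] at h1
    rw [orderOf_pow_of_dvd hp.ne_zero hd] at h1
    have := Nat.div_lt_self (orderOf_pos g) hp.one_lt
    omega

theorem edges_eq_flags (G : Type*) [Group G] [Finite G] :
    numCyclicEdges G = Nat.card (cyclicFlags G) := by
  classical
  have hgen : ∀ K : Subgroup G, ∃ g : G, IsCyclic K → K = Subgroup.zpowers g := by
    intro K
    by_cases h : IsCyclic K
    · obtain ⟨g, hg⟩ := (Subgroup.isCyclic_iff_exists_zpowers_eq_top K).1 h
      exact ⟨g, fun _ => hg.symm⟩
    · exact ⟨1, fun h' => absurd h' h⟩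
  choose gen hgen using hgen
  have hcard : ∀ K : Subgroup G, IsCyclic K → Nat.card K = orderOf (gen K) := by
    intro K hK
    rw [← Nat.card_zpowers, ← hgen K hK]
  symm
  refine Nat.card_congr (Equiv.ofBijective
    (fun e => ⟨(Subgroup.zpowers (gen e.1.1 ^ e.1.2), e.1.1), ?_⟩ :
      cyclicFlags G → cyclicGraphEdges G) ⟨?_, ?_⟩)
  · obtain ⟨⟨K, p⟩, hK, hp, hd⟩ := e
    simp only at hK hp hd ⊢
    rw [hcard K hK] at hd
    have hlt := zpowers_pow_lt (gen K) p hp hd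
    rw [← hgen K hK] at hlt
    refine ⟨inferInstance, hK, hlt, ?_⟩
    intro M _ h1 h2
    simp only at h1 h2
    have c1 : Nat.card (Subgroup.zpowers (gen K ^ p)) * p = Nat.card K := by
      rw [Nat.card_zpowers, orderOf_pow_of_dvd hp.ne_zero hd, hcard K hK]
      exact Nat.div_mul_cancel hd
    obtain ⟨a, ha⟩ := Subgroup.card_dvd_of_le h1.le
    obtain ⟨b, hb⟩ := Subgroup.card_dvd_of_le h2.le
    have hpos : 0 < Nat.card (Subgroup.zpowers (gen K ^ p)) := Nat.card_pos
    have hab : p = a * b := by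
      rw [hb, ha, mul_assoc] at c1
      exact Nat.eq_of_mul_eq_mul_left hpos c1
    rcases (Nat.prime_mul_iff.1 (hab ▸ hp)) with ⟨_, h⟩ | ⟨_, h⟩
    · subst h
      exact h2.ne (Subgroup.eq_of_le_of_card_ge h2.le (by omega))
    · subst h
      exact h1.ne (Subgroup.eq_of_le_of_card_ge h1.le (by omega))
  · rintro ⟨⟨K, p⟩, hK, hp, hd⟩ ⟨⟨K', q⟩, hK', hq, hd'⟩ h
    simp only at hK hp hd hK' hq hd'
    replace h := Prod.mk.inj (congrArg Subtype.val h)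
    obtain ⟨h, h'⟩ := h
    simp only at h h'
    subst h'
    refine Subtype.ext (Prod.ext rfl ?_)
    have h1 := congrArg (fun H : Subgroup G => Nat.card H) h
    rw [hcard K hK] at hd hd'
    simp only [Nat.card_zpowers] at h1
    rw [orderOf_pow_of_dvd hp.ne_zero hd, orderOf_pow_of_dvd hq.ne_zero hd'] at h1
    obtain ⟨a, ha⟩ := hd
    obtain ⟨b, hb⟩ := hd'
    have ho := orderOf_pos (gen K)
    have e1 : orderOf (gen K) / p = a := by rw [ha]; exact Nat.mul_div_cancel_left _ hp.pos
    have e2 : orderOf (gen K) / q = b := by rw [hb]; exact Nat.mul_div_cancel_left _ hq.pos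
    have e3 : a = b := by rw [← e1, h1, e2]
    subst e3
    have ha0 : 0 < a := by
      rcases Nat.eq_zero_or_pos a with h | h
      · subst h; omega
      · exact h
    exact Nat.eq_of_mul_eq_mul_right ha0 (ha.symm.trans hb)
  · rintro ⟨⟨H, K⟩, hH, hK, hlt, hcov⟩
    simp only at hH hK hlt hcov
    have hgK := hgen K hK
    have hmem : gen H ∈ Subgroup.zpowers (gen K) := by
      rw [← hgK]
      apply hlt.le
      have h1 := Subgroup.mem_zpowers (gen H)
      rwa [← hgen H hH] at h1
    obtain ⟨a, ha⟩ := (mem_powers_iff_mem_zpowers.2 hmem)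
    simp only at ha
    have hgcd : Nat.gcd (orderOf (gen K)) a ≠ 1 := by
      intro h1
      apply hlt.ne
      rw [hgen H hH, hgK]
      apply Subgroup.eq_of_le_of_card_ge
      · rw [Subgroup.zpowers_le, ← hgK]; rw [← hgK] at hmem; exact hmem
      · rw [Nat.card_zpowers, Nat.card_zpowers, ← ha]
        exact (Nat.Coprime.orderOf_pow h1).ge
    obtain ⟨p, hp, hpd⟩ := Nat.exists_prime_and_dvd hgcd
    have hd := hpd.trans (Nat.gcd_dvd_left _ _)
    have hl := zpowers_pow_lt (gen K) p hp hd
    rw [← hgK] at hl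
    refine ⟨⟨(K, p), hK, hp, by simpa only [hcard K hK] using hd⟩, ?_⟩
    refine Subtype.ext (Prod.ext ?_ rfl)
    simp only
    by_contra hne
    refine hcov (Subgroup.zpowers (gen K ^ p)) inferInstance (lt_of_le_of_ne ?_ (Ne.symm hne)) hl
    rw [hgen H hH, Subgroup.zpowers_le, ← ha]
    obtain ⟨c, hc⟩ := hpd.trans (Nat.gcd_dvd_right _ _)
    rw [hc, pow_mul]
    exact Subgroup.npow_mem_zpowers _ _

theorem chain_elems {G : Type*} [Group G] [Finite G] (p : ℕ) [Fact p.Prime] (m : ℕ) :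
    ∀ H : Subgroup G, Nat.card H = p ^ m → ∃ x : ℕ → G, x 0 = 1 ∧ (∀ i ≤ m, x i ∈ H) ∧
      (∀ i j, j < i → i ≤ m → x i ∉ Subgroup.zpowers (x j)) ∧
      (m ≠ 0 → ∃ M : Subgroup G, (∀ i < m, x i ∈ M) ∧ x m ∉ M) := by
  induction m with
  | zero =>
    intro H _
    refine ⟨fun _ => 1, rfl, fun i _ => H.one_mem, ?_, fun h => absurd rfl h⟩
    intro i j h1 h2; omega
  | succ m ih =>
    intro H hH
    obtain ⟨M', hM'⟩ := Sylow.exists_subgroup_card_pow_prime (G := H) p (n := m)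
      (by rw [hH]; exact pow_dvd_pow p (Nat.le_succ m))
    set M : Subgroup G := M'.map H.subtype with hM
    have hMc : Nat.card M = p ^ m := by
      rw [hM, Subgroup.card_map_of_injective H.subtype_injective, hM']
    have hMH : M ≤ H := Subgroup.map_subtype_le M'
    have hlt : ∃ h ∈ H, h ∉ M := by
      by_contra hcon
      push Not at hcon
      have : M = H := le_antisymm hMH hcon
      rw [this, hH] at hMc
      have := Nat.pow_right_injective (Fact.out : p.Prime).two_le hMc
      omega
    obtain ⟨h, hhH, hhM⟩ := hlt
    obtain ⟨x, x0, xm, xi, -⟩ := ih M hMc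
    have hlast : ∀ i < m + 1, (if i = m + 1 then h else x i) = x i := by
      intro i hi; rw [if_neg (by omega)]
    refine ⟨fun i => if i = m + 1 then h else x i, ?_, ?_, ?_, ?_⟩
    · simpa using x0
    · intro i hi
      by_cases hi' : i = m + 1
      · simpa [hi'] using hhH
      · simpa [hi'] using hMH (xm i (by omega))
    · intro i j hji hi
      by_cases hi' : i = m + 1
      · have hj : j ≠ m + 1 := by omega
        simp only [hi', hj, if_true, if_false]
        intro hc
        exact hhM ((Subgroup.zpowers_le.2 (xm j (by omega))) hc)
      · have hj : j ≠ m + 1 := by omega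
        simp only [hi', hj, if_false]
        exact xi i j hji (by omega)
    · intro _
      refine ⟨M, ?_, ?_⟩
      · intro i hi
        simp only [hlast i hi]
        exact xm i (by omega)
      · simpa using hhM

theorem pgroup_elems {G : Type*} [Group G] [Finite G] (p : ℕ) [Fact p.Prime] (m : ℕ)
    (hm : Nat.card G = p ^ m) : ∃ x : ℕ → G, x 0 = 1 ∧
      (∀ i ≤ m, i ≠ 0 → x i ≠ 1) ∧
      (∀ i ≤ m, ∀ j ≤ m, Subgroup.zpowers (x i) = Subgroup.zpowers (x j) → i = j) ∧
      ((∀ y : G, y ≠ 1 → ∃ i ≤ m, Subgroup.zpowers y = Subgroup.zpowers (x i)) → IsCyclic G) := by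
  obtain ⟨x, x0, -, xi, xM⟩ := chain_elems p m (⊤ : Subgroup G) (by simpa using hm)
  refine ⟨x, x0, ?_, ?_, ?_⟩
  · intro i hi hi0 h
    exact xi i 0 (by omega) hi (by rw [h]; exact Subgroup.one_mem _)
  · intro i hi j hj h
    rcases lt_trichotomy i j with hij | hij | hij
    · exact absurd (by rw [h]; exact Subgroup.mem_zpowers _) (xi j i hij hj)
    · exact hij
    · exact absurd (by rw [← h]; exact Subgroup.mem_zpowers _) (xi i j hij hi)
  · intro hall
    by_cases hm0 : m = 0
    · subst hm0
      have : Subsingleton G := (Nat.card_eq_one_iff_unique.1 (by simpa using hm)).1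
      infer_instance
    · obtain ⟨M, hM, hMm⟩ := xM hm0
      have hout : ∀ y, y ∉ M → y ∈ Subgroup.zpowers (x m) := by
        intro y hy
        obtain ⟨i, hi, h⟩ := hall y (by rintro rfl; exact hy M.one_mem)
        have him : i = m := by
          by_contra hne
          apply hy
          apply Subgroup.zpowers_le.2 (hM i (by omega))
          rw [← h]; exact Subgroup.mem_zpowers _
        rw [← him, ← h]; exact Subgroup.mem_zpowers _
      refine ⟨x m, fun y => ?_⟩
      by_cases hy : y ∈ M
      · have h1 : y * x m ∉ M := fun h => hMm ((M.mul_mem_cancel_left hy).1 h)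
        exact (Subgroup.mul_mem_cancel_right _ (Subgroup.mem_zpowers _)).1 (hout _ h1)
      · exact hout y hy

theorem nilp_elems (G : Type*) [Group G] [Finite G] (hG : Group.IsNilpotent G) :
    ∃ g : ℕ → G,
      (∀ d, d ∣ Nat.card G → ∀ e, e ∣ Nat.card G →
        Subgroup.zpowers (g d) = Subgroup.zpowers (g e) → d = e) ∧
      (∀ d, d ∣ Nat.card G → ∀ q : ℕ, q.Prime → q ∣ d → q ∣ orderOf (g d)) ∧
      ((∀ y : G, y ≠ 1 → ∃ d, d ∣ Nat.card G ∧ Subgroup.zpowers y = Subgroup.zpowers (g d)) →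
        IsCyclic G) := by
  classical
  have hfact (p : (Nat.card G).primeFactors) : Fact p.1.Prime :=
    ⟨Nat.prime_of_mem_primeFactors p.2⟩
  have hn0 : Nat.card G ≠ 0 := Nat.card_pos.ne'
  obtain ⟨φ⟩ := ((Group.isNilpotent_of_finite_tfae (G := G)).out 0 4).mp hG
  have key := fun (p : (Nat.card G).primeFactors) (P : Sylow p.1 G) =>
    pgroup_elems (G := P) p.1 ((Nat.card G).factorization p.1) P.card_eq_multiplicity
  choose x x0 x1 xinj xcyc using key
  have hle : ∀ d, d ∣ Nat.card G → ∀ p, d.factorization p ≤ (Nat.card G).factorization p := by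
    intro d hd p
    exact (Nat.factorization_le_iff_dvd (ne_zero_of_dvd_ne_zero hn0 hd) hn0).2 hd p
  let ev : (p : (Nat.card G).primeFactors) → (P : Sylow p.1 G) → (G →* P) := fun p P =>
    ((Pi.evalMonoidHom _ P).comp (Pi.evalMonoidHom _ p)).comp φ.symm.toMonoidHom
  have hev : ∀ p P f, ev p P (φ f) = f p P := by
    intro p P f
    simp [ev]
  refine ⟨fun d => φ (fun p P => x p P (d.factorization p)), ?_, ?_, ?_⟩
  · intro d hd e he h
    have hd0 := ne_zero_of_dvd_ne_zero hn0 hd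
    have he0 := ne_zero_of_dvd_ne_zero hn0 he
    apply Nat.eq_of_factorization_eq hd0 he0
    intro p
    by_cases hp : p ∈ (Nat.card G).primeFactors
    · have h2 := congrArg (Subgroup.map (ev ⟨p, hp⟩ default)) h
      simp only [MonoidHom.map_zpowers, hev] at h2
      exact xinj ⟨p, hp⟩ default _ (hle d hd p) _ (hle e he p) h2
    · have h0 : (Nat.card G).factorization p = 0 := by
        rwa [← Finsupp.notMem_support_iff, Nat.support_factorization]
      have := hle d hd p
      have := hle e he p
      omega
  · intro d hd q hq hqd
    have hd0 := ne_zero_of_dvd_ne_zero hn0 hd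
    have hqF := Fact.mk hq
    have hqm : q ∈ (Nat.card G).primeFactors :=
      Nat.mem_primeFactors.2 ⟨hq, hqd.trans hd, hn0⟩
    have hv : d.factorization q ≠ 0 := (hq.factorization_pos_of_dvd hd0 hqd).ne'
    have hne := x1 ⟨q, hqm⟩ default _ (hle d hd q) hv
    refine dvd_trans ?_ (orderOf_map_dvd (ev ⟨q, hqm⟩ default) _)
    rw [hev]
    obtain ⟨k, -, hk⟩ := (Nat.dvd_prime_pow hq).1
      (((default : Sylow q G).card_eq_multiplicity) ▸
        (orderOf_dvd_natCard (x ⟨q, hqm⟩ default (d.factorization q))))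
    rw [hk]
    refine dvd_pow_self _ ?_
    rintro rfl
    rw [pow_zero, orderOf_eq_one_iff] at hk
    exact hne hk
  · intro hall
    have hZ : IsZGroup G := by
      refine ⟨fun p hp P => ?_⟩
      have := Fact.mk hp
      by_cases hpm : p ∈ (Nat.card G).primeFactors
      · refine xcyc ⟨p, hpm⟩ P ?_
        intro y hy
        let f : ∀ p : (Nat.card G).primeFactors, ∀ P : Sylow p G, P :=
          Pi.mulSingle (⟨p, hpm⟩ : (Nat.card G).primeFactors) (Pi.mulSingle P y)
        have hf : f ⟨p, hpm⟩ P = y := by simp [f]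
        obtain ⟨d, hd, h⟩ := hall (φ f) (by
          intro h
          apply hy
          rw [← hf, ← hev ⟨p, hpm⟩ P f, h, map_one])
        have h2 := congrArg (Subgroup.map (ev ⟨p, hpm⟩ P)) h
        simp only [MonoidHom.map_zpowers, hev] at h2
        rw [hf] at h2
        exact ⟨_, hle d hd p, h2⟩
      · have h0 : (Nat.card G).factorization p = 0 := by
          rwa [← Finsupp.notMem_support_iff, Nat.support_factorization]
        have hc := P.card_eq_multiplicity
        rw [h0, pow_zero] at hc
        have : Subsingleton P := (Nat.card_eq_one_iff_unique.1 hc).1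
        infer_instance
    infer_instance

theorem cyclic_subgroup_ext {G : Type*} [Group G] [Finite G] [IsCyclic G] (H K : Subgroup G)
    (h : Nat.card H = Nat.card K) : H = K := by
  classical
  have := Fintype.ofFinite G
  have aux : ∀ L : Subgroup G, Nat.card L = Nat.card K →
      (L : Set G).toFinset = Finset.univ.filter (fun a : G => a ^ Nat.card K = 1) := by
    intro L hL
    apply Finset.eq_of_subset_of_card_le
    · intro a ha
      rw [Set.mem_toFinset] at ha
      simp only [Finset.mem_filter, Finset.mem_univ, true_and]
      rw [← hL]
      exact orderOf_dvd_iff_pow_eq_one.1 (Subgroup.orderOf_dvd_natCard L ha)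
    · refine (IsCyclic.card_pow_eq_one_le Nat.card_pos).trans ?_
      rw [← hL, Set.toFinset_card, ← Nat.card_eq_fintype_card]
      exact le_rfl
  have h1 := (aux H h).trans (aux K rfl).symm
  exact SetLike.coe_injective (Set.toFinset_inj.1 h1)

instance finite_cyclicFlags (G : Type*) [Group G] [Finite G] : Finite (cyclicFlags G) := by
  refine Set.Finite.subset
    ((Set.finite_univ (α := Subgroup G)).prod (Set.finite_Iic (Nat.card G))) ?_
  rintro ⟨K, q⟩ ⟨h1, h2, h3⟩
  exact ⟨trivial, Nat.le_of_dvd Nat.card_pos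
    (h3.trans (Subgroup.card_subgroup_dvd_card K))⟩

def divFlags (n : ℕ) : Set (ℕ × ℕ) := {e | e.1 ∣ n ∧ e.2.Prime ∧ e.2 ∣ e.1}

theorem edges_congr {G H : Type*} [Group G] [Group H] [Finite G] [Finite H] (φ : G ≃* H) :
    numCyclicEdges G ≤ numCyclicEdges H := by
  rw [edges_eq_flags, edges_eq_flags]
  refine Nat.card_le_card_of_injective
    (fun e => ⟨(e.1.1.map φ.toMonoidHom, e.1.2), ?_⟩ : cyclicFlags G → cyclicFlags H) ?_
  · obtain ⟨⟨K, p⟩, hK, hp, hd⟩ := e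
    simp only at hK hp hd ⊢
    have e := K.equivMapOfInjective φ.toMonoidHom φ.injective
    exact ⟨e.isCyclic.1 hK, hp, by simpa only [← Nat.card_congr e.toEquiv] using hd⟩
  · rintro ⟨⟨K, p⟩, hK⟩ ⟨⟨L, q⟩, hL⟩ h
    replace h := Prod.mk.inj (congrArg Subtype.val h)
    exact Subtype.ext (Prod.ext (Subgroup.map_injective φ.injective h.1) h.2)

theorem numCyclicEdges_nilpotent_ge (G : Type*) [Group G] [Finite G]
    (hG : Group.IsNilpotent G) :
    numCyclicEdges (Multiplicative (ZMod (Nat.card G))) ≤ numCyclicEdges G ∧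
    (numCyclicEdges G = numCyclicEdges (Multiplicative (ZMod (Nat.card G))) ↔
      IsCyclic G) := by
  have hn0 : Nat.card G ≠ 0 := Nat.card_pos.ne'
  have : NeZero (Nat.card G) := ⟨hn0⟩
  have hfinZ : Finite (Multiplicative (ZMod (Nat.card G))) :=
    inferInstanceAs (Finite (ZMod (Nat.card G)))
  have hcZ : Nat.card (Multiplicative (ZMod (Nat.card G))) = Nat.card G :=
    (Nat.card_congr Multiplicative.toAdd).trans (Nat.card_zmod _)
  have hfinD : Finite (divFlags (Nat.card G)) := by
    refine Set.Finite.subset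
      ((Set.finite_Iic (Nat.card G)).prod (Set.finite_Iic (Nat.card G))) ?_
    rintro ⟨d, q⟩ ⟨h1, h2, h3⟩
    exact ⟨Nat.le_of_dvd (Nat.pos_of_ne_zero hn0) h1,
      Nat.le_of_dvd (Nat.pos_of_ne_zero hn0) (h3.trans h1)⟩
  obtain ⟨g, ginj, gord, gcyc⟩ := nilp_elems G hG
  have hle1 : numCyclicEdges (Multiplicative (ZMod (Nat.card G))) ≤
      Nat.card (divFlags (Nat.card G)) := by
    rw [edges_eq_flags]
    refine Nat.card_le_card_of_injective
      (fun e => ⟨(Nat.card e.1.1, e.1.2), ?_, e.2.2.1, e.2.2.2⟩) ?_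
    · exact (Subgroup.card_subgroup_dvd_card e.1.1).trans hcZ.dvd
    · rintro ⟨⟨K, p⟩, hK⟩ ⟨⟨L, q⟩, hL⟩ h
      replace h := Prod.mk.inj (congrArg Subtype.val h)
      exact Subtype.ext (Prod.ext (cyclic_subgroup_ext K L h.1) h.2)
  let F : divFlags (Nat.card G) → cyclicFlags G := fun e =>
    ⟨(Subgroup.zpowers (g e.1.1), e.1.2), inferInstanceAs (IsCyclic (Subgroup.zpowers _)),
      e.2.2.1, by
        have := gord e.1.1 e.2.1 e.1.2 e.2.2.1 e.2.2.2
        simpa only [Nat.card_zpowers] using this⟩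
  have hF : Function.Injective F := by
    rintro ⟨⟨d, p⟩, hd⟩ ⟨⟨e, q⟩, he⟩ h
    replace h := Prod.mk.inj (congrArg Subtype.val h)
    exact Subtype.ext (Prod.ext (ginj d hd.1 e he.1 h.1) h.2)
  have hle2 : Nat.card (divFlags (Nat.card G)) ≤ numCyclicEdges G := by
    rw [edges_eq_flags]
    exact Nat.card_le_card_of_injective F hF
  refine ⟨hle1.trans hle2, ?_, ?_⟩
  · intro heq
    have hc : Nat.card (divFlags (Nat.card G)) = Nat.card (cyclicFlags G) := by
      rw [← edges_eq_flags]; omega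
    have hsurj : Function.Surjective F :=
      ((Nat.bijective_iff_injective_and_card F).2 ⟨hF, hc⟩).2
    apply gcyc
    intro y hy
    obtain ⟨p, hp, hpd⟩ := Nat.exists_prime_and_dvd (mt orderOf_eq_one_iff.1 hy)
    obtain ⟨⟨⟨d, q⟩, hd⟩, h⟩ := hsurj ⟨(Subgroup.zpowers y, p),
      inferInstanceAs (IsCyclic (Subgroup.zpowers _)), hp,
      by simpa only [Nat.card_zpowers] using hpd⟩
    replace h := Prod.mk.inj (congrArg Subtype.val h)
    exact ⟨d, hd.1, h.1.symm⟩
  · intro hcyc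
    have φ : Multiplicative (ZMod (Nat.card G)) ≃* G := zmodCyclicMulEquiv hcyc
    exact le_antisymm (edges_congr φ.symm) (edges_congr φ)
end

section
/- Let G be a finite group of odd order n. Then ∑_{a ∈ G} ω(o(a))/φ(o(a)) ≥ ∑_{a ∈ ℤ_n} ω(o(a))/φ(o(a)); equivalently, the cyclic subgroup graph of G has at least as many edges as that of ℤ_n. -/
/-- Weighted divisor sum: `∑_{d ∣ m} (α + ω(d))`. -/
def Fv (α m : ℕ) : ℕ := ∑ d ∈ m.divisors, (α + d.primeFactors.card)

/-- The `S`-part of `n`. -/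
def spart (S : Finset ℕ) (n : ℕ) : ℕ := ∏ p ∈ S, p ^ (n.factorization p)

/-- Bookkeeping predicate for orbit sizes and their contributions. -/
def Good (X : ℕ) (c : ℚ) : Prop :=
  (X = 1 ∧ 1 ≤ c) ∨ (X = 5 ∧ 5 / 3 ≤ c) ∨ ∃ l : ℕ, 2 ≤ l ∧ X ≤ 3 ^ l ∧ (l : ℚ) ≤ c

theorem Good.add {X Y : ℕ} {c d : ℚ} (h1 : Good X c) (h2 : Good Y d) : Good (X + Y) (c + d) := by
  have key : ∀ l : ℕ, 2 ≤ l → 9 ≤ 3 ^ l := fun l hl => by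
    calc 9 = 3 ^ 2 := by norm_num
      _ ≤ 3 ^ l := Nat.pow_le_pow_right (by norm_num) hl
  rcases h1 with ⟨rfl, hc⟩ | ⟨rfl, hc⟩ | ⟨l, hl, hX, hc⟩ <;>
  rcases h2 with ⟨rfl, hd⟩ | ⟨rfl, hd⟩ | ⟨k, hk, hY, hd⟩
  · exact Or.inr (Or.inr ⟨2, le_rfl, by norm_num, by push_cast; linarith⟩)
  · exact Or.inr (Or.inr ⟨2, le_rfl, by norm_num, by push_cast; linarith⟩)
  · refine Or.inr (Or.inr ⟨k + 1, by omega, ?_, by push_cast; linarith⟩)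
    have := key k hk
    rw [pow_succ]; omega
  · exact Or.inr (Or.inr ⟨2, le_rfl, by norm_num, by push_cast; linarith⟩)
  · exact Or.inr (Or.inr ⟨3, by norm_num, by norm_num, by push_cast; linarith⟩)
  · refine Or.inr (Or.inr ⟨k + 1, by omega, ?_, by push_cast; linarith⟩)
    have := key k hk
    rw [pow_succ]; omega
  · refine Or.inr (Or.inr ⟨l + 1, by omega, ?_, by push_cast; linarith⟩)
    have := key l hl
    rw [pow_succ]; omega
  · refine Or.inr (Or.inr ⟨l + 1, by omega, ?_, by push_cast; linarith⟩)
    have := key l hl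
    rw [pow_succ]; omega
  · refine Or.inr (Or.inr ⟨l + k, by omega, ?_, by push_cast; linarith⟩)
    have := key l hl
    have := key k hk
    rw [pow_add]; nlinarith

theorem Good.mono {X : ℕ} {c d : ℚ} (h : Good X c) (hcd : c ≤ d) : Good X d := by
  rcases h with ⟨h, hc⟩ | ⟨h, hc⟩ | ⟨l, hl, hX, hc⟩
  · exact Or.inl ⟨h, hc.trans hcd⟩
  · exact Or.inr (Or.inl ⟨h, hc.trans hcd⟩)
  · exact Or.inr (Or.inr ⟨l, hl, hX, hc.trans hcd⟩)

theorem Good.one_le {X : ℕ} {c : ℚ} (h : Good X c) : 1 ≤ c := by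
  rcases h with ⟨h, hc⟩ | ⟨h, hc⟩ | ⟨l, hl, hX, hc⟩
  · exact hc
  · linarith
  · have : (2 : ℚ) ≤ l := by exact_mod_cast hl
    linarith

theorem Good.sum {ι : Type*} (s : Finset ι) (hs : s.Nonempty) (X : ι → ℕ) (c : ι → ℚ)
    (h : ∀ i ∈ s, Good (X i) (c i)) : Good (∑ i ∈ s, X i) (∑ i ∈ s, c i) := by
  classical
  induction hs using Finset.Nonempty.cons_induction with
  | singleton a => simpa using h a (by simp)
  | cons a s ha hs ih =>
    rw [Finset.sum_cons, Finset.sum_cons]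
    exact (h a (by simp)).add (ih fun i hi => h i (by simp [hi]))

theorem Fv_pos {α m : ℕ} (hα : 1 ≤ α) (hm : m ≠ 0) : 0 < Fv α m := by
  unfold Fv
  apply Finset.sum_pos
  · intro i _; omega
  · exact ⟨1, by simp [hm]⟩

open scoped Pointwise in
theorem Fv_submul {α a b : ℕ} (hα : 1 ≤ α) (ha : a ≠ 0) (hb : b ≠ 0) :
    Fv α (a * b) ≤ Fv 1 a * Fv α b := by
  unfold Fv
  rw [Finset.sum_mul_sum, ← Finset.sum_product', Nat.divisors_mul]
  have h1 : ∑ d ∈ a.divisors * b.divisors, (α + d.primeFactors.card) ≤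
      ∑ x ∈ a.divisors ×ˢ b.divisors, (α + (x.1 * x.2).primeFactors.card) := by
    rw [Finset.mul_def, ← Finset.sum_fiberwise_of_maps_to (s := a.divisors ×ˢ b.divisors)
      (t := Finset.image (fun p => p.1 * p.2) (a.divisors ×ˢ b.divisors)) (g := fun p => p.1 * p.2)
      (fun x hx => Finset.mem_image_of_mem _ hx)]
    apply Finset.sum_le_sum
    intro d hd
    obtain ⟨x, hx, rfl⟩ := Finset.mem_image.1 hd
    refine Finset.single_le_sum (f := fun y : ℕ × ℕ => α + (y.1 * y.2).primeFactors.card) (s := (a.divisors ×ˢ b.divisors).filter _) (fun i _ => Nat.zero_le _) (a := x) ?_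
    simp only [Finset.mem_filter, and_true]; exact hx
  refine h1.trans (Finset.sum_le_sum ?_)
  rintro ⟨x, y⟩ hxy
  simp only [Finset.mem_product, Nat.mem_divisors] at hxy
  have hx : x ≠ 0 := ne_zero_of_dvd_ne_zero ha hxy.1.1
  have hy : y ≠ 0 := ne_zero_of_dvd_ne_zero hb hxy.2.1
  have : (x * y).primeFactors.card ≤ x.primeFactors.card + y.primeFactors.card := by
    rw [Nat.primeFactors_mul hx hy]; exact Finset.card_union_le _ _
  simp only
  nlinarith [Nat.zero_le (x.primeFactors.card * y.primeFactors.card),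
    Nat.mul_le_mul_left x.primeFactors.card hα]

theorem Fv_prime_pow_mul {p m : ℕ} (hp : p.Prime) (hpm : ¬ p ∣ m) (α a : ℕ) :
    Fv α (p ^ a * m) = Fv α m + a * Fv (α + 1) m := by
  have hcop : ∀ i, (p ^ i).Coprime m := fun i =>
    Nat.Coprime.pow_left _ ((Nat.Prime.coprime_iff_not_dvd hp).2 hpm)
  have hinj : Set.InjOn (fun x : ℕ × ℕ => x.1 * x.2)
      ((p ^ a).divisors ×ˢ m.divisors : Finset (ℕ × ℕ)) := by
    exact (hcop a).mul_injOn_divisors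
  unfold Fv
  rw [Nat.divisors_mul, Finset.mul_def, Finset.sum_image hinj, Finset.sum_product,
    Nat.sum_divisors_prime_pow hp, Finset.sum_range_succ', add_comm]
  congr 1
  · simp
  · rw [Finset.sum_congr rfl (g := fun _ => ∑ d ∈ m.divisors, (α + 1 + d.primeFactors.card)), Finset.sum_const, Finset.card_range, smul_eq_mul]
    intro i _
    apply Finset.sum_congr rfl
    intro d hd
    have hd' := (Nat.mem_divisors.1 hd).1
    have : (p ^ (i + 1)).Coprime d := (hcop (i + 1)).coprime_dvd_right hd'
    rw [this.primeFactors_mul, Finset.card_union_of_disjoint this.disjoint_primeFactors,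
      Nat.primeFactors_prime_pow (by omega) hp]
    simp; ring

theorem Fv_one_prime {q : ℕ} (hq : q.Prime) : Fv 1 q = 3 := by
  have := Fv_prime_pow_mul (m := 1) hq (by simpa using hq.one_lt.ne') 1 1
  simpa [Fv] using this

theorem three_clog {q : ℕ} (hq : 7 ≤ q) : ∃ l, 2 ≤ l ∧ q ≤ 3 ^ l ∧ 3 * l ≤ q ∧ l + 2 ≤ 3 * l ∧ (11 ≤ q → 3 * l + 2 ≤ q) := by
  induction q using Nat.strong_induction_on with
  | _ q ih =>
    by_cases h : q < 21
    · by_cases h9 : q ≤ 9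
      · exact ⟨2, by omega, by omega, by omega, by omega, by omega⟩
      · by_cases h10 : q ≤ 10
        · exact ⟨3, by omega, by omega, by omega, by omega, by omega⟩
        · exact ⟨3, by omega, by omega, by omega, by omega, by omega⟩
    · obtain ⟨l, h1, h2, h3, h4, h5⟩ := ih ((q + 2) / 3) (by omega) (by omega)
      exact ⟨l + 1, by omega, by rw [pow_succ]; omega, by omega, by omega, by omega⟩

theorem Fv_growth (s : ℕ) (hs : ∀ q, q.Prime → q ∣ s → 5 ≤ q) (h7 : 7 ≤ s) :
    ∃ l, 2 ≤ l ∧ s ≤ 3 ^ l ∧ l * Fv 1 s ≤ s ∧ (11 ≤ s → 3 ≤ l) := by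
  induction s using Nat.strong_induction_on with
  | _ s ih =>
    have hq : s.minFac.Prime := Nat.minFac_prime (by omega)
    have hqs := Nat.minFac_dvd s
    obtain ⟨t, ht⟩ := hqs
    have hq5 := hs _ hq (Nat.minFac_dvd s)
    set q := s.minFac with hqdef
    have htpos : 0 < t := by
      rcases Nat.eq_zero_or_pos t with h | h
      · subst h; omega
      · exact h
    have htdvd : t ∣ s := ⟨q, by rw [ht, mul_comm]⟩
    by_cases ht1 : t = 1
    · subst ht1
      have hsq : s = q := by omega
      obtain ⟨l, h1, h2, h3, -, h5⟩ := three_clog h7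
      refine ⟨l, h1, h2, ?_, ?_⟩
      · have : Fv 1 s = 3 := by rw [hsq]; exact Fv_one_prime hq
        rw [this]; omega
      · intro h
        by_contra hl
        have : l = 2 := by omega
        subst this; omega
    have htq : q ≤ t := Nat.minFac_le_of_dvd (by omega) htdvd
    have hsub : Fv 1 s ≤ 3 * Fv 1 t := by
      conv_lhs => rw [ht]
      have := Fv_submul (α := 1) (a := q) (b := t) le_rfl (by omega) (by omega)
      rwa [Fv_one_prime hq] at this
    have ht' : ∀ r, r.Prime → r ∣ t → 5 ≤ r := fun r hr hrt => hs r hr (hrt.trans htdvd)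
    have htlt : t < s := by nlinarith
    by_cases hq6 : q = 5
    · by_cases ht7 : t < 11
      · have : t = 5 ∨ t = 7 := by
          have h2 : ¬ 2 ∣ t := fun h => by have := ht' 2 Nat.prime_two h; omega
          have h3 : ¬ 3 ∣ t := fun h => by have := ht' 3 Nat.prime_three h; omega
          omega
        rcases this with h | h
        · have : s = 25 := by rw [ht, hq6, h]
          rw [this]
          refine ⟨3, by norm_num, by norm_num, by decide +kernel, by norm_num⟩
        · have : s = 35 := by rw [ht, hq6, h]
          rw [this]
          refine ⟨4, by norm_num, by norm_num, by decide +kernel, by norm_num⟩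
      · obtain ⟨l, h1, h2, h3, h4⟩ := ih t htlt ht' (by omega)
        have h4 := h4 (by omega)
        refine ⟨l + 2, by omega, ?_, ?_, by omega⟩
        · rw [ht, hq6, pow_add]; omega
        · rw [hq6] at ht
          nlinarith
    · have hq7 : 7 ≤ q := by
        have : q ≠ 6 := by intro h; rw [h] at hq; exact absurd hq (by norm_num)
        omega
      obtain ⟨l, h1, h2, h3, h4⟩ := ih t htlt ht' (by omega)
      obtain ⟨k, k1, k2, k3, k4, k5⟩ := three_clog hq7
      refine ⟨l + k, by omega, ?_, ?_, by omega⟩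
      · rw [ht, pow_add, mul_comm]; exact Nat.mul_le_mul h2 k2
      · calc (l + k) * Fv 1 s ≤ (l + k) * (3 * Fv 1 t) := Nat.mul_le_mul_left _ hsub
          _ ≤ (l * k) * (3 * Fv 1 t) := Nat.mul_le_mul_right _ (by nlinarith)
          _ = (3 * k) * (l * Fv 1 t) := by ring
          _ ≤ q * t := Nat.mul_le_mul k3 h3
          _ = s := ht.symm

theorem Good_class (s y : ℕ) (hs : ∀ q, q.Prime → q ∣ s → 5 ≤ q) (hs0 : s ≠ 0) (hy : y ≠ 0) :
    Good (s * y) ((s * y : ℕ) / (Fv 1 s : ℚ)) := by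
  have h2 : ¬ 2 ∣ s := fun h => by have := hs 2 Nat.prime_two h; omega
  have h3 : ¬ 3 ∣ s := fun h => by have := hs 3 Nat.prime_three h; omega
  have hpow : ∀ y, y ≤ 3 ^ y := fun y => (Nat.lt_pow_self (by norm_num)).le
  by_cases h7 : 7 ≤ s
  · obtain ⟨l, h1, h2, h3, -⟩ := Fv_growth s hs h7
    have hF : (0 : ℚ) < Fv 1 s := by exact_mod_cast Fv_pos le_rfl hs0
    right; right
    by_cases hy1 : y = 1
    · subst hy1
      refine ⟨l, h1, by simpa using h2, ?_⟩
      rw [le_div_iff₀ hF]; rw [mul_one]; exact_mod_cast h3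
    · refine ⟨l + (y - 1), by omega, ?_, ?_⟩
      · rw [pow_add]
        refine Nat.mul_le_mul h2 ?_
        have := Nat.lt_pow_self (n := y - 1) (show 1 < 3 by norm_num)
        omega
      · rw [le_div_iff₀ hF]
        have : (l + (y - 1)) * Fv 1 s ≤ s * y := by
          obtain ⟨z, rfl⟩ : ∃ z, y = z + 2 := ⟨y - 2, by omega⟩
          calc (l + (z + 2 - 1)) * Fv 1 s ≤ (l * (z + 2)) * Fv 1 s := Nat.mul_le_mul_right _ (by
                  have : z + 2 - 1 = z + 1 := by omega
                  rw [this]; nlinarith)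
            _ = (l * Fv 1 s) * (z + 2) := by ring
            _ ≤ s * (z + 2) := Nat.mul_le_mul_right _ h3
        exact_mod_cast this
  · have : s = 1 ∨ s = 5 := by omega
    rcases this with rfl | rfl
    · have : Fv 1 1 = 1 := by simp [Fv]
      rw [this]
      by_cases hy1 : y = 1
      · subst hy1; left; norm_num
      · right; right
        exact ⟨y, by omega, by simpa using hpow y, by simp⟩
    · have : Fv 1 5 = 3 := Fv_one_prime (by norm_num)
      rw [this]
      by_cases hy1 : y = 1
      · subst hy1; right; left; norm_num
      · right; right
        by_cases hy2 : y = 2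
        · subst hy2; exact ⟨3, by norm_num, by norm_num, by norm_num⟩
        · refine ⟨y, by omega, ?_, ?_⟩
          · obtain ⟨z, rfl⟩ : ∃ z, y = z + 3 := ⟨y - 3, by omega⟩
            have := Nat.lt_pow_self (n := z) (show 1 < 3 by norm_num)
            rw [pow_add]; omega
          · push_cast
            have : (0 : ℚ) ≤ y := by positivity
            linarith

theorem sum_totient_pow {p : ℕ} (hp : p.Prime) (e : ℕ) :
    1 + ∑ i ∈ Finset.Icc 1 e, (p ^ i).totient = p ^ e := by
  induction e with
  | zero => simp
  | succ e ih =>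
    rw [Finset.sum_Icc_succ_top (by omega), ← add_assoc, ih, Nat.totient_prime_pow_succ hp, pow_succ]
    have := hp.one_lt
    obtain ⟨k, rfl⟩ : ∃ k, p = k + 1 := ⟨p - 1, by omega⟩
    simp; ring

theorem total_bound {p : ℕ} (hp : p.Prime) (hp3 : 3 ≤ p) (a e : ℕ) (ha : 1 ≤ a) (hea : e ≤ a)
    (k : ℕ → ℕ) (c : ℕ → ℚ) (hg : ∀ i ∈ Finset.Icc 1 e, Good (k i) (c i))
    (hk : p ^ a ≤ 1 + ∑ i ∈ Finset.Icc 1 e, k i * (p ^ i).totient) :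
    (a : ℚ) ≤ ∑ i ∈ Finset.Icc 1 e, c i ∨
      (p = 3 ∧ a = e + 1 ∧ 1 ≤ e ∧ k e = 5 ∧ ∀ i ∈ Finset.Icc 1 e, i ≠ e → k i = 1) := by
  have hone : ∀ i ∈ Finset.Icc 1 e, 1 ≤ c i := fun i hi => (hg i hi).one_le
  have hcard : ∀ T ⊆ Finset.Icc 1 e, (T.card : ℚ) ≤ ∑ i ∈ T, c i := fun T hT => by
    have := Finset.card_nsmul_le_sum T c 1 (fun i hi => hone i (hT hi))
    simpa using this
  rcases hea.eq_or_lt with rfl | hlt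
  · left; simpa using hcard _ (Finset.Subset.refl _)
  obtain ⟨r, rfl⟩ : ∃ r, a = e + (r + 1) := ⟨a - e - 1, by omega⟩
  have hex : ∃ i ∈ Finset.Icc 1 e, p ^ (r + 1) + 1 ≤ k i := by
    by_contra! hcon
    have h1 : ∑ i ∈ Finset.Icc 1 e, k i * (p ^ i).totient ≤ p ^ (r + 1) * ∑ i ∈ Finset.Icc 1 e, (p ^ i).totient := by
      rw [Finset.mul_sum]
      exact Finset.sum_le_sum fun i hi => Nat.mul_le_mul_right _ (by have := hcon i hi; omega)
    have h2 := sum_totient_pow hp e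
    have h3 : 3 ≤ p ^ (r + 1) := hp3.trans (Nat.le_self_pow (by omega) p)
    rw [pow_add, ← h2] at hk
    nlinarith
  obtain ⟨i, hi, hki⟩ := hex
  have hi' := Finset.mem_Icc.1 hi
  have h3 : 3 ^ (r + 1) ≤ p ^ (r + 1) := Nat.pow_le_pow_left hp3 _
  have hce : ((Finset.Icc 1 e).erase i).card + 1 = e := by
    rw [Finset.card_erase_of_mem hi]; simp; omega
  have hsum : ∑ j ∈ Finset.Icc 1 e, c j = c i + ∑ j ∈ (Finset.Icc 1 e).erase i, c j :=
    (Finset.add_sum_erase _ _ hi).symm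
  have hce' : (((Finset.Icc 1 e).erase i).card : ℚ) + 1 = e := by exact_mod_cast hce
  have her := hcard _ (Finset.erase_subset i (Finset.Icc 1 e))
  rcases hg i hi with ⟨h, hc⟩ | ⟨h, hc⟩ | ⟨l, hl, hX, hc⟩
  · have : 0 < 3 ^ (r + 1) := by positivity
    omega
  · have hp4 : p ≤ 4 := by
      have : p ≤ p ^ (r + 1) := Nat.le_self_pow (by omega) p
      omega
    have hp3' : p = 3 := by
      interval_cases p
      · rfl
      · exact absurd hp (by norm_num)
    subst hp3'
    have hr : r = 0 := by
      by_contra hr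
      have : 3 ^ 2 ≤ 3 ^ (r + 1) := Nat.pow_le_pow_right (by norm_num) (by omega)
      omega
    subst hr
    by_cases hall : ∀ j ∈ Finset.Icc 1 e, j ≠ i → k j = 1
    · right
      have hie : i = e := by
        by_contra hne
        have h1 : ∑ j ∈ Finset.Icc 1 e, k j * (3 ^ j).totient =
            ∑ j ∈ Finset.Icc 1 e, (3 ^ j).totient + 4 * (3 ^ i).totient := by
          rw [← Finset.add_sum_erase _ _ hi, ← Finset.add_sum_erase _ (fun j : ℕ => ((3 : ℕ) ^ j).totient) hi, h]
          rw [Finset.sum_congr rfl (g := fun j => (3 ^ j).totient)]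
          · ring
          · intro j hj
            rw [Finset.mem_erase] at hj
            rw [hall j hj.2 hj.1, one_mul]
        have h2 := sum_totient_pow hp e
        rw [h1] at hk
        have h4 : (3 ^ i).totient ≤ 3 ^ i := Nat.totient_le _
        have h4 : (3 ^ i).totient * 3 = 3 ^ i * 2 := by
          obtain ⟨i', rfl⟩ : ∃ i', i = i' + 1 := ⟨i - 1, by omega⟩
          rw [Nat.totient_prime_pow_succ hp, pow_succ]; ring
        have h5 : 3 ^ (i + 1) ≤ 3 ^ e := Nat.pow_le_pow_right (by norm_num) (by omega)
        rw [pow_succ] at h5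
        have h6 : 0 < 3 ^ i := by positivity
        have h7 : 3 ^ (e + (0 + 1)) = 3 ^ e * 3 := by rw [pow_add]; norm_num
        omega
      subst hie
      exact ⟨rfl, rfl, by omega, h, hall⟩
    · left
      push Not at hall
      obtain ⟨j, hj, hji, hkj⟩ := hall
      have hcj : 5 / 3 ≤ c j := by
        rcases hg j hj with ⟨h, hc⟩ | ⟨h, hc⟩ | ⟨l, hl, hX, hc⟩
        · exact absurd h hkj
        · exact hc
        · have : (2 : ℚ) ≤ l := by exact_mod_cast hl
          linarith
      have hje : j ∈ (Finset.Icc 1 e).erase i := Finset.mem_erase.2 ⟨hji, hj⟩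
      rw [hsum, ← Finset.add_sum_erase _ _ hje]
      have h8 := hcard (((Finset.Icc 1 e).erase i).erase j)
        ((Finset.erase_subset _ _).trans (Finset.erase_subset _ _))
      have h9 : (((Finset.Icc 1 e).erase i).erase j).card + 1 = ((Finset.Icc 1 e).erase i).card := by
        rw [Finset.card_erase_of_mem hje]
        have := Finset.card_pos.2 ⟨j, hje⟩
        omega
      have h9' : ((((Finset.Icc 1 e).erase i).erase j).card : ℚ) + 1 = ((Finset.Icc 1 e).erase i).card := by
        exact_mod_cast h9
      push_cast
      linarith
  · left
    have hl' : r + 2 ≤ l := by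
      by_contra hcon
      have : 3 ^ l ≤ 3 ^ (r + 1) := Nat.pow_le_pow_right (by norm_num) (by omega)
      omega
    have hl'' : (r : ℚ) + 2 ≤ l := by exact_mod_cast hl'
    rw [hsum]; push_cast; linarith

theorem spart_insert {S : Finset ℕ} {p : ℕ} (hp : p ∉ S) (n : ℕ) :
    spart (insert p S) n = p ^ n.factorization p * spart S n := Finset.prod_insert hp

theorem spart_mul (S : Finset ℕ) {a b : ℕ} (ha : a ≠ 0) (hb : b ≠ 0) :
    spart S (a * b) = spart S a * spart S b := by
  unfold spart
  rw [← Finset.prod_mul_distrib]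
  refine Finset.prod_congr rfl fun p _ => ?_
  rw [Nat.factorization_mul ha hb, Finsupp.add_apply, pow_add]

theorem spart_eq_one (S : Finset ℕ) {n : ℕ} (h : ∀ p ∈ S, ¬ p ∣ n) : spart S n = 1 :=
  Finset.prod_eq_one fun p hp => by rw [Nat.factorization_eq_zero_of_not_dvd (h p hp), pow_zero]

theorem spart_ne_zero {S : Finset ℕ} (hS : ∀ p ∈ S, p.Prime) (n : ℕ) : spart S n ≠ 0 :=
  Finset.prod_ne_zero_iff.2 fun p hp => pow_ne_zero _ (hS p hp).ne_zero

theorem mem_of_dvd_spart {S : Finset ℕ} (hS : ∀ p ∈ S, p.Prime) {n q : ℕ} (hq : q.Prime)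
    (h : q ∣ spart S n) : q ∈ S := by
  obtain ⟨p, hp, hqp⟩ := (hq.prime.dvd_finset_prod_iff _).1 h
  have := (Nat.prime_dvd_prime_iff_eq hq (hS p hp)).1 (hq.dvd_of_dvd_pow hqp)
  rwa [this]

theorem spart_dvd {S : Finset ℕ} (hS : ∀ p ∈ S, p.Prime) (n : ℕ) : spart S n ∣ n := by
  apply Finset.prod_dvd_of_isRelPrime
  · intro p hp q hq hpq
    simp only [Function.onFun]
    rw [← Nat.coprime_iff_isRelPrime]
    exact Nat.Coprime.pow _ _ ((Nat.coprime_primes (hS p hp) (hS q hq)).2 hpq)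
  · intro p _
    exact Nat.ordProj_dvd n p

theorem spart_primeFactors {n : ℕ} (hn : n ≠ 0) : spart n.primeFactors n = n :=
  Nat.prod_factorization_pow_eq_self hn

/-- The cyclic subgroups of order `n`. -/
noncomputable def cycSub (G : Type*) [Group G] [Finite G] (n : ℕ) : Finset (Subgroup G) :=
  (Set.toFinite {U : Subgroup G | IsCyclic U ∧ Nat.card U = n}).toFinset

theorem mem_cycSub {G : Type*} [Group G] [Finite G] {n : ℕ} {U : Subgroup G} :
    U ∈ cycSub G n ↔ IsCyclic U ∧ Nat.card U = n := by
  simp [cycSub]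

open scoped Classical in
theorem card_generators {G : Type*} [Group G] [Fintype G] {n : ℕ} {U : Subgroup G}
    (hU : U ∈ cycSub G n) :
    (Finset.univ.filter fun u : G => orderOf u = n ∧ Subgroup.zpowers u = U).card = n.totient := by
  obtain ⟨hc, hn⟩ := mem_cycSub.1 hU
  have h := IsCyclic.card_orderOf_eq_totient (α := U) (d := n)
    (by rw [← Nat.card_eq_fintype_card, hn])
  rw [← h]
  symm
  refine Finset.card_bij (fun a _ => (a : G)) ?_ ?_ ?_
  · intro a ha
    simp only [Finset.mem_filter, Finset.mem_univ, true_and] at ha ⊢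
    refine ⟨by rw [Subgroup.orderOf_coe, ha], ?_⟩
    apply Subgroup.eq_of_le_of_card_ge
    · rw [Subgroup.zpowers_le]; exact a.2
    · rw [Nat.card_zpowers, Subgroup.orderOf_coe, ha, hn]
  · intro a _ b _ hab
    exact Subtype.ext hab
  · intro u hu
    simp only [Finset.mem_filter, Finset.mem_univ, true_and] at hu
    have hm : u ∈ U := by rw [← hu.2]; exact Subgroup.mem_zpowers u
    refine ⟨⟨u, hm⟩, ?_, rfl⟩
    simp only [Finset.mem_filter, Finset.mem_univ, true_and]
    rw [← Subgroup.orderOf_coe]; exact hu.1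

open scoped Classical in
theorem sum_zpowers {G : Type*} [Group G] [Fintype G] {M : Type*} [AddCommMonoid M] (n : ℕ)
    (f : Subgroup G → M) :
    ∑ u : G with orderOf u = n, f (Subgroup.zpowers u) = n.totient • ∑ U ∈ cycSub G n, f U := by
  rw [← Finset.sum_fiberwise_of_maps_to (t := cycSub G n) (g := fun u => Subgroup.zpowers u),
    Finset.smul_sum]
  · refine Finset.sum_congr rfl fun U hU => ?_
    rw [Finset.filter_filter, ← card_generators hU, ← Finset.sum_const]
    refine Finset.sum_congr rfl fun u hu => ?_
    rw [(Finset.mem_filter.1 hu).2.2]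
  · intro u hu
    rw [mem_cycSub]
    refine ⟨inferInstance, ?_⟩
    rw [Nat.card_zpowers]; exact (Finset.mem_filter.1 hu).2

theorem spart_centralizer {G : Type*} [Group G] [Finite G] {p : ℕ} (hp : p.Prime) {i : ℕ}
    {S : Finset ℕ} (hS : ∀ q ∈ S, q.Prime) (hpS : ∀ q ∈ S, p < q) {U : Subgroup G}
    (hU : U ∈ cycSub G (p ^ i)) :
    spart S (Nat.card G) = spart S (Subgroup.normalizer (U : Set G)).index *
      spart S (Nat.card (Subgroup.centralizer (U : Set G))) := by
  obtain ⟨hc, hn⟩ := mem_cycSub.1 hU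
  have key := Subgroup.card_dvd_of_injective _
    (QuotientGroup.kerLift_injective U.normalizerMonoidHom)
  rw [Subgroup.normalizerMonoidHom_ker, ← Subgroup.index, ← Subgroup.relIndex, hc.card_mulAut,
    hn] at key
  have hle : Subgroup.centralizer (U : Set G) ≤ Subgroup.normalizer (U : Set G) :=
    Subgroup.centralizer_le_normalizer _
  have h1 := Subgroup.relIndex_mul_index hle
  have h2 := Subgroup.card_mul_index (Subgroup.centralizer (U : Set G))
  have hN0 : (Subgroup.normalizer (U : Set G)).index ≠ 0 := Subgroup.index_ne_zero_of_finite
  have hC0 : (Subgroup.centralizer (U : Set G)).index ≠ 0 := Subgroup.index_ne_zero_of_finite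
  have hR0 : (Subgroup.centralizer (U : Set G)).relIndex (Subgroup.normalizer (U : Set G)) ≠ 0 := by
    intro h; rw [h, zero_mul] at h1; exact hC0 h1.symm
  have hone : spart S ((Subgroup.centralizer (U : Set G)).relIndex
      (Subgroup.normalizer (U : Set G))) = 1 := by
    apply spart_eq_one
    intro q hq hdvd
    have hd := hdvd.trans key
    have hqp := hpS q hq
    have hq' := hS q hq
    rcases Nat.eq_zero_or_pos i with h0 | h0
    · rw [h0, pow_zero, Nat.totient_one] at hd
      exact hq'.one_lt.ne' (Nat.dvd_one.1 hd)
    · rw [Nat.totient_prime_pow hp h0] at hd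
      rcases hq'.dvd_mul.1 hd with h | h
      · have := Nat.le_of_dvd hp.pos (hq'.dvd_of_dvd_pow h)
        omega
      · have := Nat.le_of_dvd (by have := hp.two_le; omega) h
        omega
  rw [← h2, spart_mul S Nat.card_pos.ne' hC0, ← h1, spart_mul S hR0 hN0, hone, one_mul, mul_comm]

open scoped Pointwise in
theorem conj_smul_mem_cycSub {G : Type*} [Group G] [Finite G] {n : ℕ} {U : Subgroup G} (g : G)
    (hU : U ∈ cycSub G n) : MulAut.conj g • U ∈ cycSub G n := by
  obtain ⟨hc, hn⟩ := mem_cycSub.1 hU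
  rw [mem_cycSub]
  refine ⟨?_, ?_⟩
  · exact isCyclic_of_surjective (Subgroup.equivSMul (MulAut.conj g) U)
      (Subgroup.equivSMul (MulAut.conj g) U).surjective
  · rw [← hn]; exact (Nat.card_congr (Subgroup.equivSMul (MulAut.conj g) U).toEquiv).symm

open scoped Pointwise in
theorem conj_smul_eq_iff {G : Type*} [Group G] [Finite G] {U : Subgroup G} (g : G) :
    MulAut.conj g • U = U ↔ g ∈ Subgroup.normalizer (U : Set G) := by
  rw [Subgroup.mem_normalizer_iff_map_conj_eq]
  rfl

open scoped Pointwise Classical in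
theorem level_good {G : Type*} [Group G] [Finite G] {p : ℕ} (hp : p.Prime) (hp3 : 3 ≤ p) {i : ℕ}
    {S : Finset ℕ} (hS : ∀ q ∈ S, q.Prime) (hpS : ∀ q ∈ S, p < q) {β : ℕ} (hβ : 1 ≤ β)
    (hne : (cycSub G (p ^ i)).Nonempty) :
    Good (cycSub G (p ^ i)).card (∑ U ∈ cycSub G (p ^ i),
      (Fv β (spart S (Nat.card (Subgroup.centralizer (U : Set G)))) : ℚ) /
        Fv β (spart S (Nat.card G))) := by
  letI : MulAction G (Subgroup G) := MulAction.compHom _ (MulAut.conj : G →* MulAut G)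
  set Y := cycSub G (p ^ i) with hY
  have hmem : ∀ (g : G) (U : Subgroup G), U ∈ Y → g • U ∈ Y :=
    fun g U hU => conj_smul_mem_cycSub g hU
  let orb : Subgroup G → Set (Subgroup G) := fun U => MulAction.orbit G U
  rw [Finset.card_eq_sum_card_image orb, ← Finset.sum_fiberwise_of_maps_to (s := Y)
    (t := Y.image orb) (g := orb) (fun x hx => Finset.mem_image_of_mem _ hx)]
  apply Good.sum _ (hne.image _)
  intro O hO
  obtain ⟨U, hU, rfl⟩ := Finset.mem_image.1 hO
  have hfib : ((Y.filter fun V => orb V = orb U : Finset (Subgroup G)) : Set (Subgroup G)) =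
      MulAction.orbit G U := by
    ext V
    simp only [Finset.coe_filter, Set.mem_setOf_eq, orb, MulAction.orbit_eq_iff]
    constructor
    · exact fun h => h.2
    · rintro ⟨g, rfl⟩
      exact ⟨hmem g U hU, ⟨g, rfl⟩⟩
  have hstab : ∀ V : Subgroup G, MulAction.stabilizer G V = Subgroup.normalizer (V : Set G) := by
    intro V
    ext g
    rw [MulAction.mem_stabilizer_iff]
    exact conj_smul_eq_iff g
  have hcard : ∀ V, orb V = orb U → (Subgroup.normalizer (V : Set G)).index =
      (Y.filter fun V => orb V = orb U).card := by
    intro V hV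
    rw [← hstab, MulAction.index_stabilizer, ← Set.ncard_coe_finset, hfib]
    exact congrArg _ hV
  set x := (Y.filter fun V => orb V = orb U).card with hx
  have hx0 : x ≠ 0 := by
    rw [← hcard U rfl]; exact Subgroup.index_ne_zero_of_finite
  obtain ⟨y, hy⟩ := spart_dvd hS x
  have hy0 : y ≠ 0 := by rintro rfl; rw [mul_zero] at hy; exact hx0 hy
  have hs5 : ∀ q, q.Prime → q ∣ spart S x → 5 ≤ q := by
    intro q hq hqs
    have h1 := hpS q (mem_of_dvd_spart hS hq hqs)
    have h4 : q ≠ 4 := by rintro rfl; exact absurd hq (by norm_num)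
    omega
  have hg := Good_class (spart S x) y hs5 (spart_ne_zero hS x) hy0
  rw [← hy] at hg
  refine hg.mono ?_
  rw [div_eq_mul_one_div, ← nsmul_eq_mul]
  apply Finset.card_nsmul_le_sum
  intro V hV
  rw [Finset.mem_filter] at hV
  have hm := spart_centralizer hp hS hpS hV.1
  rw [hcard V hV.2] at hm
  have hF1 : (0 : ℚ) < Fv 1 (spart S x) := by
    exact_mod_cast Fv_pos le_rfl (spart_ne_zero hS x)
  have hF2 : (0 : ℚ) < Fv β (spart S (Nat.card G)) := by
    exact_mod_cast Fv_pos hβ (spart_ne_zero hS _)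
  rw [div_le_div_iff₀ hF1 hF2, one_mul, mul_comm, hm]
  exact_mod_cast Fv_submul hβ (spart_ne_zero hS _) (spart_ne_zero hS _)

open scoped Classical in
theorem count_sub {G : Type*} [Group G] [Finite G] {p : ℕ} (hp : p.Prime) {a e : ℕ}
    (P : Subgroup G) (hP : Nat.card P = p ^ a)
    (he : ∀ i ≤ a, (cycSub G (p ^ i)).Nonempty → i ≤ e) :
    p ^ a = ∑ i ∈ Finset.range (e + 1),
      (p ^ i).totient * ((cycSub G (p ^ i)).filter (· ≤ P)).card := by
  have := Fintype.ofFinite G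
  have hord : ∀ g ∈ P, ∃ i ≤ a, orderOf g = p ^ i := by
    intro g hg
    have := P.orderOf_dvd_natCard hg
    rw [hP] at this
    exact (Nat.dvd_prime_pow hp).1 this
  have h0 : p ^ a = (Finset.univ.filter fun g : G => g ∈ P).card := by
    rw [← hP, Nat.card_eq_fintype_card, Fintype.card_subtype]
  rw [h0, Finset.card_eq_sum_card_fiberwise (f := fun g => (orderOf g).factorization p)
    (t := Finset.range (e + 1))]
  · refine Finset.sum_congr rfl fun i _ => ?_
    have h := sum_zpowers (G := G) (p ^ i) (fun U => if U ≤ P then (1 : ℕ) else 0)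
    rw [smul_eq_mul, ← Finset.card_filter, ← Finset.card_filter] at h
    rw [← h, Finset.filter_filter, Finset.filter_filter]
    congr 1
    ext g
    simp only [Finset.mem_filter, Finset.mem_univ, true_and, Subgroup.zpowers_le]
    constructor
    · rintro ⟨hg, hi⟩
      obtain ⟨j, _, hj⟩ := hord g hg
      rw [hj, hp.factorization_pow, Finsupp.single_eq_same] at hi
      exact ⟨by rw [hj, hi], hg⟩
    · rintro ⟨ho, hg⟩
      exact ⟨hg, by rw [ho, hp.factorization_pow, Finsupp.single_eq_same]⟩
  · intro g hg
    simp only [Finset.coe_filter, Finset.mem_univ, true_and, Set.mem_setOf_eq] at hg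
    obtain ⟨j, hja, hj⟩ := hord g hg
    have : j ≤ e := he j hja ⟨Subgroup.zpowers g, mem_cycSub.2 ⟨inferInstance, by
      rw [Nat.card_zpowers, hj]⟩⟩
    simp only [Finset.coe_range, Set.mem_Iio]
    rw [hj, hp.factorization_pow, Finsupp.single_eq_same]
    omega

theorem cycSub_down {G : Type*} [Group G] [Finite G] {p : ℕ} (hp : p.Prime) {i j : ℕ} (hij : i ≤ j)
    (h : (cycSub G (p ^ j)).Nonempty) : (cycSub G (p ^ i)).Nonempty := by
  obtain ⟨U, hU⟩ := h
  obtain ⟨hc, hn⟩ := mem_cycSub.1 hU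
  obtain ⟨g, hg⟩ := (Subgroup.isCyclic_iff_exists_zpowers_eq_top U).1 hc
  have ho : orderOf g = p ^ j := by rw [← Nat.card_zpowers, hg, hn]
  refine ⟨Subgroup.zpowers (g ^ p ^ (j - i)), mem_cycSub.2 ⟨inferInstance, ?_⟩⟩
  rw [Nat.card_zpowers, orderOf_pow_of_dvd (pow_ne_zero _ hp.ne_zero), ho,
    Nat.pow_div (by omega) hp.pos]
  · congr 1; omega
  · rw [ho]; exact pow_dvd_pow _ (by omega)

open scoped Classical in
theorem filter_one_le {G : Type*} [Group G] [Finite G] (P : Subgroup G) :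
    ((cycSub G 1).filter (· ≤ P)).card ≤ 1 := by
  rw [Finset.card_le_one]
  intro U hU V hV
  simp only [Finset.mem_filter, mem_cycSub] at hU hV
  rw [Subgroup.eq_bot_of_card_eq _ hU.1.2, Subgroup.eq_bot_of_card_eq _ hV.1.2]

open scoped Pointwise Classical in
theorem sylow_bound {G : Type*} [Group G] [Finite G] {p : ℕ} (hp : p.Prime) (hp3 : 3 ≤ p)
    {S : Finset ℕ} (hS : ∀ q ∈ S, q.Prime) (hpS : ∀ q ∈ S, p < q) {β : ℕ} (hβ : 1 ≤ β) :
    (((Nat.card G).factorization p : ℕ) : ℚ) * Fv β (spart S (Nat.card G)) ≤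
      ∑ i ∈ Finset.Icc 1 ((Nat.card G).factorization p), ∑ U ∈ cycSub G (p ^ i),
        (Fv β (spart S (Nat.card (Subgroup.centralizer (U : Set G)))) : ℚ) := by
  haveI := Fact.mk hp
  obtain ⟨P⟩ : Nonempty (Sylow p G) := inferInstance
  have hP := P.card_eq_multiplicity
  set a := (Nat.card G).factorization p with ha
  rcases Nat.eq_zero_or_pos a with h0 | hapos
  · rw [h0]; simp
  set e := Nat.findGreatest (fun i => (cycSub G (p ^ i)).Nonempty) a with he
  have hea : e ≤ a := Nat.findGreatest_le a
  have hne0 : (cycSub G (p ^ 0)).Nonempty :=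
    ⟨⊥, mem_cycSub.2 ⟨inferInstance, by simp⟩⟩
  have hene : (cycSub G (p ^ e)).Nonempty :=
    Nat.findGreatest_spec (P := fun i => (cycSub G (p ^ i)).Nonempty) (Nat.zero_le a) hne0
  have hmax : ∀ i ≤ a, (cycSub G (p ^ i)).Nonempty → i ≤ e := fun i hi h =>
    Nat.le_findGreatest hi h
  have hcount := count_sub hp P.1 hP hmax
  set b : ℕ → ℕ := fun i => ((cycSub G (p ^ i)).filter (· ≤ P.1)).card with hb
  have hb0 : b 0 ≤ 1 := by
    have := filter_one_le P.1
    simpa [hb] using this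
  have hbk : ∀ i, b i ≤ (cycSub G (p ^ i)).card := fun i => Finset.card_filter_le _ _
  have hcount2 : p ^ a = b 0 + ∑ i ∈ Finset.Icc 1 e, b i * (p ^ i).totient := by
    rw [hcount, Finset.range_eq_Ico, Finset.sum_eq_sum_Ico_succ_bot (by omega)]
    simp only [pow_zero, Nat.totient_one, one_mul]
    congr 1
    refine Finset.sum_congr ?_ fun i _ => mul_comm _ _
    ext i; simp
  have hF2 : (0 : ℚ) < Fv β (spart S (Nat.card G)) := by
    exact_mod_cast Fv_pos hβ (spart_ne_zero hS _)
  have hk : p ^ a ≤ 1 + ∑ i ∈ Finset.Icc 1 e, (cycSub G (p ^ i)).card * (p ^ i).totient := by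
    rw [hcount2]
    exact Nat.add_le_add hb0 (Finset.sum_le_sum fun i _ => Nat.mul_le_mul_right _ (hbk i))
  rcases total_bound hp hp3 a e hapos hea (fun i => (cycSub G (p ^ i)).card)
    (fun i => ∑ U ∈ cycSub G (p ^ i),
      (Fv β (spart S (Nat.card (Subgroup.centralizer (U : Set G)))) : ℚ) /
        Fv β (spart S (Nat.card G)))
    (fun i hi => level_good hp hp3 hS hpS hβ
      (cycSub_down hp (Finset.mem_Icc.1 hi).2 hene)) hk with h | h
  · simp only [← Finset.sum_div] at h
    rw [le_div_iff₀ hF2] at h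
    refine h.trans ?_
    apply Finset.sum_le_sum_of_subset_of_nonneg
    · exact Finset.Icc_subset_Icc le_rfl hea
    · intro i _ _
      exact Finset.sum_nonneg fun U _ => Nat.cast_nonneg _
  · exfalso
    obtain ⟨rfl, hae, he1, hke, hki⟩ := h
    obtain ⟨t, ht⟩ : ∃ t, e = t + 1 := ⟨e - 1, by omega⟩
    have htot : (3 ^ e).totient = 2 * 3 ^ t := by
      rw [ht, Nat.totient_prime_pow_succ hp]; omega
    -- lower bound on the number of subgroups contained in the Sylow subgroup
    have hsplit : ∑ i ∈ Finset.Icc 1 e, b i * (3 ^ i).totient =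
        ∑ i ∈ Finset.Icc 1 t, b i * (3 ^ i).totient + b e * (3 ^ e).totient := by
      rw [ht, Finset.sum_Icc_succ_top (by omega)]
    have hlow : ∑ i ∈ Finset.Icc 1 t, b i * (3 ^ i).totient ≤
        ∑ i ∈ Finset.Icc 1 t, (3 ^ i).totient := by
      refine Finset.sum_le_sum fun i hi => ?_
      rw [Finset.mem_Icc] at hi
      have := hki i (Finset.mem_Icc.2 ⟨hi.1, by omega⟩) (by omega)
      have h2 := hbk i
      rw [this] at h2
      exact (Nat.mul_le_mul_right ((3 ^ i).totient) h2).trans (one_mul _).le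
    have hst := sum_totient_pow hp t
    have h3t : 0 < 3 ^ t := by positivity
    have hpa : 3 ^ a = 9 * 3 ^ t := by rw [hae, ht, pow_succ, pow_succ]; ring
    rw [hsplit, htot, hpa] at hcount2
    have hbe : b e = 4 := by
      have h1 : 9 * 3 ^ t ≤ 3 ^ t + b e * (2 * 3 ^ t) := by omega
      have h2 : b e * (2 * 3 ^ t) ≤ 9 * 3 ^ t := by omega
      have h3 : 9 ≤ 1 + b e * 2 := by
        apply Nat.le_of_mul_le_mul_right _ h3t
        calc 9 * 3 ^ t ≤ _ := h1
          _ = _ := by ring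
      have h4 : b e * 2 ≤ 9 := by
        apply Nat.le_of_mul_le_mul_right _ h3t
        calc _ = b e * (2 * 3 ^ t) := by ring
          _ ≤ _ := h2
      omega
    have hcompl : ((cycSub G (3 ^ e)).filter (fun U => ¬ U ≤ P.1)).card = 1 := by
      have := Finset.card_filter_add_card_filter_not (s := cycSub G (3 ^ e)) (fun U => U ≤ P.1)
      have h2 : ((cycSub G (3 ^ e)).filter (fun U => U ≤ P.1)).card = 4 := hbe
      omega
    obtain ⟨U, hU⟩ := Finset.card_eq_one.1 hcompl
    have hUm : U ∈ (cycSub G (3 ^ e)).filter (fun U => ¬ U ≤ P.1) := by rw [hU]; simp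
    rw [Finset.mem_filter] at hUm
    have hnorm : P.1 ≤ Subgroup.normalizer (U : Set G) := by
      intro g hg
      rw [← conj_smul_eq_iff]
      have hm : MulAut.conj g • U ∈ (cycSub G (3 ^ e)).filter (fun U => ¬ U ≤ P.1) := by
        rw [Finset.mem_filter]
        refine ⟨conj_smul_mem_cycSub g hUm.1, fun hle => hUm.2 fun x hx => ?_⟩
        have h1 : g * x * g⁻¹ ∈ P.1 := by
          apply hle
          have := Subgroup.smul_mem_pointwise_smul x (MulAut.conj g) U hx
          simpa using this
        have h2 := P.1.mul_mem (P.1.mul_mem (P.1.inv_mem hg) h1) hg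
        simpa [mul_assoc] using h2
      rw [hU] at hm
      exact Finset.mem_singleton.1 hm
    have hUp : IsPGroup 3 U := IsPGroup.of_card (mem_cycSub.1 hUm.1).2
    have hsup : IsPGroup 3 (P.1 ⊔ U : Subgroup G) :=
      IsPGroup.to_sup_of_normal_right' P.2 hUp hnorm
    have heq := P.3 hsup le_sup_left
    apply hUm.2
    calc U ≤ P.1 ⊔ U := le_sup_right
      _ = P.1 := heq

open scoped Classical in
/-- Weighted sum over the elements whose order only involves primes in `S`. -/
noncomputable def Tv (S : Finset ℕ) (α : ℕ) (G : Type*) [Group G] [Fintype G] : ℚ :=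
  ∑ g : G with (orderOf g).primeFactors ⊆ S,
    ((α : ℚ) + (orderOf g).primeFactors.card) / (orderOf g).totient

open scoped Classical in
theorem Tv_centralizer {G : Type*} [Group G] [Fintype G] (S : Finset ℕ) (β : ℕ) (u : G) :
    Tv S β (Subgroup.centralizer ((Subgroup.zpowers u : Subgroup G) : Set G)) =
    ∑ v : G with Commute u v ∧ (orderOf v).primeFactors ⊆ S,
      ((β : ℚ) + (orderOf v).primeFactors.card) / (orderOf v).totient := by
  unfold Tv
  have hmem : ∀ v : G, v ∈ Subgroup.centralizer ((Subgroup.zpowers u : Subgroup G) : Set G) ↔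
      Commute u v := by
    intro v
    rw [Subgroup.mem_centralizer_iff]
    constructor
    · intro h; exact h u (Subgroup.mem_zpowers u)
    · intro h w hw
      obtain ⟨k, rfl⟩ := Subgroup.mem_zpowers_iff.1 hw
      exact (h.zpow_left k)
  refine Finset.sum_bij (fun v _ => (v : G)) ?_ ?_ ?_ ?_
  · intro v hv
    simp only [Finset.mem_filter, Finset.mem_univ, true_and] at hv ⊢
    exact ⟨(hmem _).1 v.2, by rw [Subgroup.orderOf_coe]; exact hv⟩
  · intro a _ b _ h; exact Subtype.ext h
  · intro v hv
    simp only [Finset.mem_filter, Finset.mem_univ, true_and] at hv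
    refine ⟨⟨v, (hmem v).2 hv.1⟩, ?_, rfl⟩
    simp only [Finset.mem_filter, Finset.mem_univ, true_and]
    rw [← Subgroup.orderOf_coe]; exact hv.2
  · intro v _
    rw [Subgroup.orderOf_coe]

open scoped Classical in
theorem Tv_decomp {G : Type*} [Group G] [Fintype G] {p : ℕ} (hp : p.Prime) {S : Finset ℕ}
    (hpS : p ∉ S) (α : ℕ) :
    Tv S α G + ∑ i ∈ Finset.Icc 1 ((Nat.card G).factorization p), ∑ u : G with orderOf u = p ^ i,
      (1 / ((p ^ i).totient : ℚ)) *
        Tv S (α + 1) (Subgroup.centralizer ((Subgroup.zpowers u : Subgroup G) : Set G)) ≤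
    Tv (insert p S) α G := by
  set a := (Nat.card G).factorization p with ha
  set m := Nat.card G / p ^ a with hm
  have hG0 : Nat.card G ≠ 0 := Nat.card_pos.ne'
  have hGm : p ^ a * m = Nat.card G := Nat.ordProj_mul_ordCompl_eq_self _ _
  have hcop : Nat.Coprime (p ^ a) m := (Nat.coprime_ordCompl hp hG0).pow_left a
  obtain ⟨E, hE1, hE2⟩ := Nat.chineseRemainder hcop 1 0
  have hnp : ∀ v : G, (orderOf v).primeFactors ⊆ S → ¬ p ∣ orderOf v := by
    intro v hv h
    exact hpS (hv (Nat.mem_primeFactors.2 ⟨hp, h, (orderOf_pos v).ne'⟩))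
  have hproj : ∀ (i : ℕ) (u v : G), i ≤ a → orderOf u = p ^ i → Commute u v →
      (orderOf v).primeFactors ⊆ S → (u * v) ^ E = u := by
    intro i u v hi hu huv hv
    have h1 : u ^ E = u := by
      conv_rhs => rw [← pow_one u]
      rw [pow_eq_pow_iff_modEq, hu]
      exact hE1.of_dvd (pow_dvd_pow p hi)
    have h2 : v ^ E = 1 := by
      rw [← orderOf_dvd_iff_pow_eq_one]
      have hd : orderOf v ∣ p ^ a * m := by rw [hGm]; exact orderOf_dvd_natCard v
      have hc : Nat.Coprime (orderOf v) (p ^ a) :=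
        (Nat.Coprime.pow_left a ((Nat.Prime.coprime_iff_not_dvd hp).2 (hnp v hv))).symm
      exact (hc.dvd_of_dvd_mul_left hd).trans (Nat.modEq_zero_iff_dvd.1 hE2)
    rw [huv.mul_pow, h1, h2, mul_one]
  -- the index set of the decomposition
  set D : Finset (Σ _ : ℕ, Σ _ : G, G) := (Finset.Icc 1 a).sigma fun i =>
    (Finset.univ.filter fun u : G => orderOf u = p ^ i).sigma fun u =>
      Finset.univ.filter fun v : G => Commute u v ∧ (orderOf v).primeFactors ⊆ S with hD
  set w : G → ℚ := fun g => ((α : ℚ) + (orderOf g).primeFactors.card) / (orderOf g).totient with hw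
  have hw0 : ∀ g, 0 ≤ w g := fun g => by positivity
  have hDm : ∀ x ∈ D, (1 ≤ x.1 ∧ x.1 ≤ a) ∧ orderOf x.2.1 = p ^ x.1 ∧
      Commute x.2.1 x.2.2 ∧ (orderOf x.2.2).primeFactors ⊆ S := by
    rintro ⟨i, u, v⟩ hx
    simpa [hD, Finset.mem_sigma] using hx
  have hordm : ∀ x ∈ D, orderOf (x.2.1 * x.2.2) = p ^ x.1 * orderOf x.2.2 ∧
      Nat.Coprime (p ^ x.1) (orderOf x.2.2) := by
    intro x hx
    obtain ⟨_, hu, hc, hv⟩ := hDm x hx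
    have hc' : Nat.Coprime (p ^ x.1) (orderOf x.2.2) :=
      Nat.Coprime.pow_left _ ((Nat.Prime.coprime_iff_not_dvd hp).2 (hnp _ hv))
    refine ⟨?_, hc'⟩
    rw [hc.orderOf_mul_eq_mul_orderOf_of_coprime (by rw [hu]; exact hc'), hu]
  have hsum : ∑ i ∈ Finset.Icc 1 a, ∑ u : G with orderOf u = p ^ i,
      (1 / ((p ^ i).totient : ℚ)) *
        Tv S (α + 1) (Subgroup.centralizer ((Subgroup.zpowers u : Subgroup G) : Set G)) =
      ∑ x ∈ D, w (x.2.1 * x.2.2) := by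
    rw [hD, Finset.sum_sigma]
    refine Finset.sum_congr rfl fun i hi => ?_
    rw [Finset.sum_sigma]
    refine Finset.sum_congr rfl fun u hu => ?_
    rw [Tv_centralizer, Finset.mul_sum]
    refine Finset.sum_congr rfl fun v hv => ?_
    have hx : (⟨i, u, v⟩ : Σ _ : ℕ, Σ _ : G, G) ∈ D :=
      Finset.mem_sigma.2 ⟨hi, Finset.mem_sigma.2 ⟨hu, hv⟩⟩
    obtain ⟨h1, h2⟩ := hordm _ hx
    simp only at h1 h2
    have hi0 : i ≠ 0 := by have := (Finset.mem_Icc.1 hi).1; omega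
    simp only [hw]
    rw [h1, Nat.totient_mul h2, h2.primeFactors_mul, Nat.primeFactors_prime_pow hi0 hp,
      Finset.card_union_of_disjoint, Finset.card_singleton]
    · push_cast
      rw [div_mul_div_comm]
      ring
    · have := h2.disjoint_primeFactors
      rwa [Nat.primeFactors_prime_pow hi0 hp] at this
  have hinj : Set.InjOn (fun x : Σ _ : ℕ, Σ _ : G, G => x.2.1 * x.2.2) D := by
    rintro ⟨i, u, v⟩ hx ⟨j, u', v'⟩ hy hxy
    obtain ⟨hi, hu, hc, hv⟩ := hDm _ hx
    obtain ⟨hj, hu', hc', hv'⟩ := hDm _ hy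
    simp only at hi hu hc hv hj hu' hc' hv' hxy
    have h1 := hproj i u v hi.2 hu hc hv
    have h2 := hproj j u' v' hj.2 hu' hc' hv'
    rw [hxy, h2] at h1
    subst h1
    have h3 : v = v' := mul_left_cancel hxy
    subst h3
    have h4 : i = j := Nat.pow_right_injective hp.two_le (hu.symm.trans hu')
    subst h4
    rfl
  rw [hsum, ← Finset.sum_image hinj]
  unfold Tv
  rw [← Finset.sum_union]
  · apply Finset.sum_le_sum_of_subset_of_nonneg
    · intro g hg
      rw [Finset.mem_filter]
      refine ⟨Finset.mem_univ _, ?_⟩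
      rcases Finset.mem_union.1 hg with h | h
      · exact (Finset.mem_filter.1 h).2.trans (Finset.subset_insert _ _)
      · obtain ⟨x, hx, rfl⟩ := Finset.mem_image.1 h
        obtain ⟨h1, h2⟩ := hordm x hx
        obtain ⟨hi, _, _, hv⟩ := hDm x hx
        rw [h1, h2.primeFactors_mul, Nat.primeFactors_prime_pow (by omega) hp]
        exact Finset.union_subset (by simp) (hv.trans (Finset.subset_insert _ _))
    · intro g _ _; exact hw0 g
  · rw [Finset.disjoint_left]
    intro g hg h
    obtain ⟨x, hx, rfl⟩ := Finset.mem_image.1 h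
    obtain ⟨h1, h2⟩ := hordm x hx
    obtain ⟨hi, _, _, hv⟩ := hDm x hx
    apply hnp _ (Finset.mem_filter.1 hg).2
    rw [h1]
    exact (dvd_pow_self p (by omega)).mul_right _

open scoped Classical in
theorem main_ineq.{u} (S : Finset ℕ) : (∀ q ∈ S, q.Prime ∧ 3 ≤ q) → ∀ (α : ℕ) (G : Type u) [Group G]
    [Fintype G], (Fv α (spart S (Nat.card G)) : ℚ) ≤ Tv S α G := by
  induction S using Finset.induction_on_min with
  | empty =>
    intro _ α G _ _
    have h1 : spart ∅ (Nat.card G) = 1 := rfl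
    rw [h1]
    have h2 : Fv α 1 = α := by simp [Fv]
    rw [h2]
    unfold Tv
    have h3 := Finset.single_le_sum
      (f := fun g : G => ((α : ℚ) + (orderOf g).primeFactors.card) / (orderOf g).totient)
      (s := Finset.univ.filter fun g : G => (orderOf g).primeFactors ⊆ ∅) (a := 1)
      (fun g _ => by positivity) (by simp)
    simpa using h3
  | insert p S hlt ih =>
    intro hS α G _ _
    have hpp := hS p (Finset.mem_insert_self _ _)
    have hS' : ∀ q ∈ S, q.Prime ∧ 3 ≤ q := fun q hq => hS q (Finset.mem_insert_of_mem hq)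
    have hSp : ∀ q ∈ S, q.Prime := fun q hq => (hS' q hq).1
    have hpS : p ∉ S := fun h => lt_irrefl _ (hlt p h)
    have hnd : ¬ p ∣ spart S (Nat.card G) := fun h => hpS (mem_of_dvd_spart hSp hpp.1 h)
    refine le_trans ?_ (Tv_decomp hpp.1 hpS α)
    rw [spart_insert hpS, Fv_prime_pow_mul hpp.1 hnd]
    push_cast
    refine add_le_add (ih hS' α G) ((sylow_bound hpp.1 hpp.2 hSp hlt (by omega)).trans ?_)
    refine Finset.sum_le_sum fun i hi => ?_
    have ht : (0 : ℚ) < (p ^ i).totient := by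
      exact_mod_cast Nat.totient_pos.2 (pow_pos hpp.1.pos i)
    have h := sum_zpowers (G := G) (p ^ i) (fun U => (1 / ((p ^ i).totient : ℚ)) *
      (Fv (α + 1) (spart S (Nat.card (Subgroup.centralizer (U : Set G)))) : ℚ))
    rw [← Finset.mul_sum (s := cycSub G (p ^ i)), nsmul_eq_mul, ← mul_assoc, mul_one_div_cancel ht.ne', one_mul] at h
    rw [← h]
    refine Finset.sum_le_sum fun u _ => ?_
    exact mul_le_mul_of_nonneg_left (ih hS' (α + 1) _) (by positivity)

theorem cyclic_sum (C : Type*) [Group C] [Fintype C] [IsCyclic C] :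
    (∑ a : C, ((orderOf a).primeFactors.card : ℚ) / (orderOf a).totient) =
      Fv 0 (Fintype.card C) := by
  classical
  rw [← Finset.sum_fiberwise_of_maps_to (t := (Fintype.card C).divisors) (g := orderOf)]
  · unfold Fv
    push_cast
    refine Finset.sum_congr rfl fun d hd => ?_
    have hd' := Nat.dvd_of_mem_divisors hd
    have hc := IsCyclic.card_orderOf_eq_totient (α := C) hd'
    have ht : (0 : ℚ) < d.totient := by
      exact_mod_cast Nat.totient_pos.2 (Nat.pos_of_mem_divisors hd)
    rw [Finset.sum_congr rfl (g := fun _ => (d.primeFactors.card : ℚ) / d.totient),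
      Finset.sum_const, hc, nsmul_eq_mul, mul_div_cancel₀ _ ht.ne', zero_add]
    intro a ha
    rw [(Finset.mem_filter.1 ha).2]
  · intro a _
    exact Nat.mem_divisors.2 ⟨orderOf_dvd_card, Fintype.card_ne_zero⟩

theorem sum_omega_div_totient_odd_order (G : Type*) [Group G] [Fintype G]
    (n : ℕ) [NeZero n] (hn : Fintype.card G = n) (hodd : Odd n) :
    (∑ a : Multiplicative (ZMod n),
        ((orderOf a).primeFactors.card : ℚ) / (orderOf a).totient) ≤
      ∑ a : G, ((orderOf a).primeFactors.card : ℚ) / (orderOf a).totient := by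
  classical
  rw [cyclic_sum]
  have hcard : Fintype.card (Multiplicative (ZMod n)) = n := by
    rw [Fintype.card_multiplicative, ZMod.card]
  have hG : Nat.card G = n := by rw [Nat.card_eq_fintype_card, hn]
  have h := main_ineq n.primeFactors (fun q hq => ?_) 0 G
  · rw [hG, spart_primeFactors (NeZero.ne n)] at h
    rw [hcard]
    refine h.trans (le_of_eq ?_)
    unfold Tv
    rw [Finset.filter_true_of_mem]
    · simp
    · intro g _
      exact Nat.primeFactors_mono (by rw [← hn]; exact orderOf_dvd_card) (NeZero.ne n)
  · obtain ⟨hq1, hq2, _⟩ := Nat.mem_primeFactors.1 hq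
    refine ⟨hq1, ?_⟩
    have h2 := hq1.two_le
    rcases h2.eq_or_lt with h2 | h2
    · subst h2
      exact absurd hq2 (Nat.two_dvd_ne_zero.2 (Nat.odd_iff.1 hodd))
    · exact h2
end

section
/- Let G be a finite group of odd order n with |E(C(G)*)| = |E(C(ℤ_n)*)|. Then G is cyclic. -/
universe u
def Rough (q d : ℕ) : Prop := ∀ p ∈ d.primeFactors, q ≤ p

instance instDecidableRough (q d : ℕ) : Decidable (Rough q d) := by
  unfold Rough; infer_instance

def ff (t q n : ℕ) : ℕ := ∑ d ∈ n.divisors with Rough q d, (t + d.primeFactors.card)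

theorem ff_small8 : ∀ s < 136, ff 1 4 s ≤ 8 := by decide +kernel
theorem ff_small5 : ∀ s < 35, ff 1 4 s ≤ 5 := by decide +kernel
theorem ff_small3 : ∀ s < 25, ff 1 4 s ≤ 3 := by decide +kernel
theorem ff_small1 : ∀ s < 5, ff 1 4 s ≤ 1 := by decide +kernel
theorem ff_small1' : ∀ s < 7, ff 1 6 s ≤ 1 := by decide +kernel

theorem Rough.of_dvd {q d e : ℕ} (h : Rough q d) (hd : d ≠ 0) (he : e ∣ d) : Rough q e :=
  fun p hp => h p (Nat.primeFactors_mono he hd hp)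

theorem sum_le_of_subset_image {α : Type*} (D : Finset ℕ) (X : Finset α)
    (g : α → ℕ) (h : ℕ → ℕ) (w : α → ℕ) (hsub : D ⊆ X.image g)
    (hw : ∀ x ∈ X, h (g x) ≤ w x) : ∑ d ∈ D, h d ≤ ∑ x ∈ X, w x := by
  classical
  have hch : ∀ d : D, ∃ x ∈ X, g x = d := by
    intro d
    simpa using hsub d.2
  choose c hc1 hc2 using hch
  have hinj : Function.Injective c := by
    intro a b hab
    apply Subtype.ext
    rw [← hc2 a, ← hc2 b, hab]
  calc ∑ d ∈ D, h d = ∑ d : D, h d := (Finset.sum_coe_sort D h).symm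
    _ ≤ ∑ d : D, w (c d) := Finset.sum_le_sum (fun d _ => by
        have := hw (c d) (hc1 d)
        rwa [hc2] at this)
    _ = ∑ x ∈ Finset.univ.image c, w x := by
        rw [Finset.sum_image (fun a _ b _ hab => hinj hab)]
    _ ≤ ∑ x ∈ X, w x := Finset.sum_le_sum_of_subset (by
        intro x hx
        simp only [Finset.mem_image, Finset.mem_univ, true_and] at hx
        obtain ⟨d, rfl⟩ := hx
        exact hc1 d)

theorem ff_mul (t q m s : ℕ) (hm : m ≠ 0) (hs : s ≠ 0) :
    ff (t + 1) q (m * s) ≤ ff (t + 1) q m * ff 1 q s := by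
  unfold ff
  rw [Finset.sum_mul_sum, ← Finset.sum_product']
  apply sum_le_of_subset_image _ _ (fun x => x.1 * x.2)
  · intro d hd
    simp only [Finset.mem_filter, Nat.mem_divisors] at hd
    obtain ⟨a, b, ha, hb, rfl⟩ := (Nat.dvd_mul).1 hd.1.1
    have h0 : a * b ≠ 0 := fun h => hd.1.2 (by simpa [h] using hd.1.1)
    simp only [Finset.mem_image, Finset.mem_product, Finset.mem_filter, Nat.mem_divisors]
    exact ⟨(a, b), ⟨⟨⟨ha, hm⟩, hd.2.of_dvd h0 (Dvd.intro _ rfl)⟩,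
      ⟨⟨hb, hs⟩, hd.2.of_dvd h0 (Dvd.intro_left _ rfl)⟩⟩, rfl⟩
  · rintro ⟨a, b⟩ hx
    simp only [Finset.mem_product, Finset.mem_filter, Nat.mem_divisors] at hx
    have ha : a ≠ 0 := fun h => hx.1.1.2 (by simpa [h] using hx.1.1.1)
    have hb : b ≠ 0 := fun h => hx.2.1.2 (by simpa [h] using hx.2.1.1)
    simp only
    rw [Nat.primeFactors_mul ha hb]
    have := Finset.card_union_le a.primeFactors b.primeFactors
    nlinarith [Nat.zero_le (t * b.primeFactors.card),
      Nat.zero_le (a.primeFactors.card * b.primeFactors.card)]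

theorem ff_le_of_dvd (t q n m : ℕ) (hm : m ≠ 0) (h : ∀ d, d ∣ n → Rough q d → d ∣ m) :
    ff t q n ≤ ff t q m := by
  unfold ff
  apply Finset.sum_le_sum_of_subset
  intro d hd
  simp only [Finset.mem_filter, Nat.mem_divisors] at hd ⊢
  exact ⟨⟨h d hd.1.1 hd.2, hm⟩, hd.2⟩

theorem ff_anti (t q q' n : ℕ) (h : q ≤ q') : ff t q' n ≤ ff t q n := by
  unfold ff
  apply Finset.sum_le_sum_of_subset
  intro d hd
  simp only [Finset.mem_filter] at hd ⊢
  exact ⟨hd.1, fun p hp => h.trans (hd.2 p hp)⟩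

theorem ff_pos (t q n : ℕ) (hn : n ≠ 0) : 0 < ff (t + 1) q n := by
  unfold ff
  apply Finset.sum_pos
  · intros; positivity
  · exact ⟨1, Finset.mem_filter.2 ⟨by simp [hn], by simp [Rough]⟩⟩

theorem Rough.succ_of {q d : ℕ} (h : Rough q d) (hq : ¬ (q.Prime ∧ q ∣ d)) : Rough (q + 1) d := by
  intro p hp
  have h1 := h p hp
  rcases h1.lt_or_eq with h2 | h2
  · exact h2
  · subst h2
    exact absurd ⟨Nat.prime_of_mem_primeFactors hp, Nat.dvd_of_mem_primeFactors hp⟩ hq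

theorem ff_prime (t p n : ℕ) (hp : p.Prime) (hn : n ≠ 0) :
    ff t p n ≤ ff t (p + 1) n + n.factorization p * ff (t + 1) (p + 1) n := by
  have key : ∑ d ∈ n.divisors with Rough p d, (t + d.primeFactors.card) ≤
      ∑ x ∈ Finset.range (n.factorization p + 1) ×ˢ {d ∈ n.divisors | Rough (p + 1) d},
        (if x.1 = 0 then t + x.2.primeFactors.card else t + 1 + x.2.primeFactors.card) := by
    apply sum_le_of_subset_image _ _ (fun x => p ^ x.1 * x.2)
    · intro d hd
      simp only [Finset.mem_filter, Nat.mem_divisors] at hd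
      have h0 : d ≠ 0 := fun h => hd.1.2 (by simpa [h] using hd.1.1)
      obtain ⟨i, e, he, hd'⟩ := Nat.exists_eq_pow_mul_and_not_dvd h0 p hp.ne_one
      simp only [Finset.mem_image, Finset.mem_product, Finset.mem_filter, Nat.mem_divisors,
        Finset.mem_range]
      have hed : e ∣ d := hd' ▸ Dvd.intro_left _ rfl
      refine ⟨(i, e), ⟨?_, ⟨hed.trans hd.1.1, hn⟩, ?_⟩, hd'.symm⟩
      · have : p ^ i ∣ n := (hd' ▸ Dvd.intro _ rfl : p ^ i ∣ d).trans hd.1.1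
        have := (hp.pow_dvd_iff_le_factorization hn).1 this
        simp only; omega
      · exact (hd.2.of_dvd h0 hed).succ_of (fun h => he h.2)
    · rintro ⟨i, e⟩ hx
      simp only [Finset.mem_product, Finset.mem_filter, Nat.mem_divisors] at hx
      have he : e ≠ 0 := fun h => hx.2.1.2 (by simpa [h] using hx.2.1.1)
      simp only
      split_ifs with hi
      · simp [hi]
      · rw [Nat.primeFactors_mul (pow_ne_zero _ hp.ne_zero) he,
          Nat.primeFactors_prime_pow hi hp]
        have := Finset.card_union_le {p} e.primeFactors
        simp at this ⊢
        omega
  unfold ff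
  refine key.trans (le_of_eq ?_)
  rw [Finset.sum_product, Finset.sum_range_succ']
  simp [add_comm]

theorem ff_prime_pow (q a : ℕ) (hq : q.Prime) : ff 1 4 (q ^ a) ≤ 1 + 2 * a := by
  unfold ff
  refine (Finset.sum_le_sum_of_subset (Finset.filter_subset _ _)).trans ?_
  rw [Nat.divisors_prime_pow hq, Finset.sum_map, Finset.sum_range_succ']
  simp only [Function.Embedding.coeFn_mk]
  rw [Finset.sum_congr rfl (fun i _ => by
    rw [Nat.primeFactors_prime_pow (Nat.succ_ne_zero i) hq])]
  simp
  omega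

theorem ff_prime_pow_small (q a : ℕ) (hq : q.Prime) (h : q < 4) : ff 1 4 (q ^ a) ≤ 1 := by
  have : ff 1 4 (q ^ a) ≤ ff 1 4 1 := by
    apply ff_le_of_dvd _ _ _ _ one_ne_zero
    intro d hd hr
    by_contra hne
    have hd1 : d ≠ 1 := fun h => hne (by simp [h])
    have hmf := Nat.minFac_prime hd1
    have h1 : d.minFac = q := (Nat.prime_dvd_prime_iff_eq hmf hq).1
      (hmf.dvd_of_dvd_pow ((Nat.minFac_dvd d).trans hd))
    have := hr d.minFac (Nat.mem_primeFactors.2 ⟨hmf, Nat.minFac_dvd d, fun h0 => by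
      rw [h0] at hd; exact absurd (zero_dvd_iff.1 hd) (pow_ne_zero _ hq.ne_zero)⟩)
    omega
  exact this.trans (ff_small1 1 (by norm_num))

theorem ff_cube_aux (s : ℕ) : ¬ 5 ∣ s → s ≠ 0 → ff 1 4 s ^ 3 ≤ s ^ 2 := by
  induction s using Nat.recOnPosPrimePosCoprime with
  | prime_pow q a hq ha =>
    intro h5 _
    by_cases h4 : q < 4
    · have := ff_prime_pow_small q a hq h4
      calc ff 1 4 (q ^ a) ^ 3 ≤ 1 ^ 3 := Nat.pow_le_pow_left this 3
        _ ≤ _ := by simpa using Nat.one_le_pow _ _ (Nat.pos_of_ne_zero (pow_ne_zero a hq.ne_zero))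
    · have h7 : 7 ≤ q := by
        by_contra h
        have : q = 4 ∨ q = 5 ∨ q = 6 := by omega
        rcases this with rfl | rfl | rfl
        · revert hq; decide
        · exact h5 (dvd_pow_self _ ha.ne')
        · revert hq; decide
      have key : ∀ a : ℕ, (1 + 2 * a) ^ 3 ≤ 49 ^ a := by
        intro a
        induction a with
        | zero => norm_num
        | succ b ih =>
          rw [pow_succ 49]
          nlinarith [Nat.zero_le b, Nat.zero_le (b^2), Nat.zero_le (b^3)]
      calc ff 1 4 (q ^ a) ^ 3 ≤ (1 + 2 * a) ^ 3 := Nat.pow_le_pow_left (ff_prime_pow q a hq) 3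
        _ ≤ 49 ^ a := key a
        _ = (7 ^ a) ^ 2 := by rw [← pow_mul, mul_comm, pow_mul]; norm_num
        _ ≤ _ := Nat.pow_le_pow_left (Nat.pow_le_pow_left h7 a) 2
  | zero => simp
  | one => intro _ _; have := ff_small1 1 (by norm_num); exact (Nat.pow_le_pow_left this 3)
  | coprime a b ha hb hab iha ihb =>
    intro h5 h0
    have h1 := iha (fun h => h5 (h.mul_right _)) (by omega)
    have h2 := ihb (fun h => h5 (h.mul_left _)) (by omega)
    calc ff 1 4 (a * b) ^ 3 ≤ (ff 1 4 a * ff 1 4 b) ^ 3 :=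
          Nat.pow_le_pow_left (ff_mul 0 4 a b (by omega) (by omega)) 3
      _ = ff 1 4 a ^ 3 * ff 1 4 b ^ 3 := by ring
      _ ≤ a ^ 2 * b ^ 2 := Nat.mul_le_mul h1 h2
      _ = _ := by ring

theorem ff_cube (s : ℕ) (hs : s ≠ 0) : 25 * ff 1 4 s ^ 3 ≤ 27 * s ^ 2 := by
  obtain ⟨a, m, hm, rfl⟩ := Nat.exists_eq_pow_mul_and_not_dvd hs 5 (by norm_num)
  have hm0 : m ≠ 0 := by rintro rfl; simp at hm
  have key : ∀ a : ℕ, 25 * (1 + 2 * a) ^ 3 ≤ 27 * 25 ^ a := by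
    intro a
    induction a with
    | zero => norm_num
    | succ b ih =>
      rcases Nat.eq_zero_or_pos b with rfl | hb
      · norm_num
      rw [pow_succ 25]
      nlinarith [Nat.zero_le b, Nat.zero_le (b^2), Nat.zero_le (b^3)]
  have h1 : ff 1 4 (5 ^ a) ^ 3 ≤ (1 + 2 * a) ^ 3 :=
    Nat.pow_le_pow_left (ff_prime_pow 5 a (by norm_num)) 3
  calc 25 * ff 1 4 (5 ^ a * m) ^ 3 ≤ 25 * (ff 1 4 (5 ^ a) * ff 1 4 m) ^ 3 :=
        Nat.mul_le_mul_left _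
          (Nat.pow_le_pow_left (ff_mul 0 4 _ m (by positivity) hm0) 3)
    _ = (25 * ff 1 4 (5 ^ a) ^ 3) * ff 1 4 m ^ 3 := by ring
    _ ≤ (27 * 25 ^ a) * m ^ 2 :=
        Nat.mul_le_mul ((Nat.mul_le_mul_left _ h1).trans (key a)) (ff_cube_aux m hm hm0)
    _ = 27 * (5 ^ a * m) ^ 2 := by
        rw [mul_pow, ← pow_mul, mul_comm a 2, pow_mul]; ring

theorem ff_bound_C (s S : ℕ) (hs : s ≠ 0) (hsS : s ≤ S) (hS : 2 ≤ S) :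
    5 * ff 1 4 s ≤ 3 * S := by
  by_cases h5 : s < 5
  · have := ff_small1 s h5
    omega
  · have h := ff_cube s hs
    have h1 : (5 * ff 1 4 s) ^ 3 ≤ (3 * s) ^ 3 := by
      have : 5 * s ^ 2 ≤ s * s ^ 2 := Nat.mul_le_mul_right _ (by omega)
      nlinarith
    have := (Nat.pow_le_pow_iff_left (by norm_num : (3:ℕ) ≠ 0)).1 h1
    omega

theorem ff_bound_B (s S : ℕ) (hs : s ≠ 0) (hsS : s ≤ S) : ff 1 4 s ≤ S := by
  by_cases h : 2 ≤ S
  · have := ff_bound_C s S hs hsS h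
    omega
  · have := ff_small1 s (by omega)
    omega

theorem ff_bound_A (s S r : ℕ) (hs : s ≠ 0) (hsS : s ≤ S) (hr : 1 ≤ r) (hS : 3 ^ r + 1 ≤ S)
    (h5 : S ≠ 5) (h6 : S ≠ 6) : (r + 1) * ff 1 4 s < S := by
  by_cases hr4 : r ≤ 4
  · by_cases hlt : S < 136
    · have h8 := ff_small8 s (by omega)
      have g5 := ff_small5 s
      have g3 := ff_small3 s
      have g1 := ff_small1 s
      interval_cases r <;> norm_num at hS <;> omega
    · have h := ff_cube s hs
      have : ((r + 1) * ff 1 4 s) ^ 3 < S ^ 3 := by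
        have e1 : (r + 1) ^ 3 ≤ 125 := by
          calc (r+1)^3 ≤ 5 ^ 3 := Nat.pow_le_pow_left (by omega) 3
            _ = _ := by norm_num
        have e2 : s ^ 2 ≤ S ^ 2 := Nat.pow_le_pow_left hsS 2
        have e3 : 136 * S ^ 2 ≤ S * S ^ 2 := Nat.mul_le_mul_right _ (by omega)
        have e4 : 0 < S ^ 2 := by
          have : 0 < S := by omega
          positivity
        have e5 : (r + 1) ^ 3 * ff 1 4 s ^ 3 ≤ 125 * ff 1 4 s ^ 3 := Nat.mul_le_mul_right _ e1
        rw [mul_pow]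
        nlinarith
      exact lt_of_pow_lt_pow_left₀ 3 (by positivity) this
  · have hgen : ∀ r : ℕ, 5 ≤ r → 27 * (r + 1) ^ 3 ≤ 25 * 3 ^ r := by
      intro r hr
      induction r, hr using Nat.le_induction with
      | base => norm_num
      | succ n hn ih =>
        rw [pow_succ 3]
        nlinarith [Nat.zero_le n, Nat.mul_le_mul hn hn, Nat.mul_le_mul (Nat.mul_le_mul hn hn) hn, Nat.mul_le_mul_right (n^2) hn]
    have hg := hgen r (by omega)
    have h := ff_cube s hs
    have : ((r + 1) * ff 1 4 s) ^ 3 < S ^ 3 := by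
      have e2 : s ^ 2 ≤ S ^ 2 := Nat.pow_le_pow_left hsS 2
      have e4 : 0 < S ^ 2 := by have : 0 < S := by omega
                                positivity
      have e5 : (r+1)^3 * (25 * ff 1 4 s ^ 3) ≤ (r+1)^3 * (27 * S ^ 2) :=
        Nat.mul_le_mul_left _ (h.trans (Nat.mul_le_mul_left _ e2))
      have e6 : 27 * (r+1)^3 * S^2 < 25 * S * S ^ 2 := Nat.mul_lt_mul_of_pos_right (by omega) e4
      rw [mul_pow]
      nlinarith
    exact lt_of_pow_lt_pow_left₀ 3 (by positivity) this

theorem totient_pow_sum (p j : ℕ) (hp : p.Prime) :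
    ∑ i ∈ Finset.Icc 1 j, (p ^ i).totient + 1 = p ^ j := by
  induction j with
  | zero => simp
  | succ n ih =>
    rw [Finset.sum_Icc_succ_top (by omega), Nat.totient_prime_pow_succ hp, pow_succ]
    have : 1 ≤ p := hp.one_le
    obtain ⟨q, rfl⟩ : ∃ q, p = q + 1 := ⟨p - 1, by omega⟩
    simp only [Nat.add_sub_cancel]
    nlinarith

theorem numeric_core (p j k : ℕ) (hp : p.Prime) (hp3 : 3 ≤ p) (hjk : j ≤ k) (hj : k ≠ 0 → j ≠ 0)
    (S SP : ℕ → ℕ) (sg : ℕ → ℚ)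
    (h1 : ∀ i ∈ Finset.Icc 1 j, 1 ≤ SP i) (h1' : ∀ i ∈ Finset.Icc 1 j, SP i ≤ S i)
    (h2 : ∑ i ∈ Finset.Icc 1 j, (p ^ i).totient * SP i + 1 = p ^ k)
    (h3 : ∀ i ∈ Finset.Icc 1 j, S i ≡ SP i [MOD p])
    (h4 : ∀ i ∈ Finset.Icc 1 j, 1 ≤ sg i)
    (h5 : ∀ i ∈ Finset.Icc 1 j, 2 ≤ S i → 5 / 3 ≤ sg i)
    (h6 : ∀ i ∈ Finset.Icc 1 j, ∀ r : ℕ, 1 ≤ r → p ^ r + 1 ≤ S i →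
      (p = 3 → S i ≠ 5 ∧ S i ≠ 6) → (r : ℚ) + 1 < sg i) :
    (k : ℚ) ≤ ∑ i ∈ Finset.Icc 1 j, sg i ∧
    (∑ i ∈ Finset.Icc 1 j, sg i ≤ k → j = k ∧ (k ≠ 0 → S k = 1)) := by
  have hrest : ∀ i ∈ Finset.Icc 1 j,
      (j : ℚ) - 1 + sg i ≤ ∑ i ∈ Finset.Icc 1 j, sg i := by
    intro i hi
    rw [← Finset.add_sum_erase _ _ hi]
    have : (((Finset.Icc 1 j).erase i).card : ℚ) * 1 ≤ ∑ l ∈ (Finset.Icc 1 j).erase i, sg l := by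
      rw [← nsmul_eq_mul]
      exact Finset.card_nsmul_le_sum _ _ _ (fun l hl => h4 l (Finset.mem_of_mem_erase hl))
    rw [Finset.card_erase_of_mem hi, Nat.card_Icc] at this
    have hj1 : 1 ≤ j := by simp at hi; omega
    push_cast [Nat.add_sub_cancel, Nat.cast_sub hj1] at this
    linarith
  have hrest2 : ∀ i ∈ Finset.Icc 1 j, ∀ l ∈ Finset.Icc 1 j, l ≠ i →
      (j : ℚ) - 2 + sg i + sg l ≤ ∑ i ∈ Finset.Icc 1 j, sg i := by
    intro i hi l hl hli
    have hl' : l ∈ (Finset.Icc 1 j).erase i := Finset.mem_erase.2 ⟨hli, hl⟩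
    rw [← Finset.add_sum_erase _ _ hi, ← Finset.add_sum_erase _ _ hl']
    have : ((((Finset.Icc 1 j).erase i).erase l).card : ℚ) * 1 ≤
        ∑ m ∈ ((Finset.Icc 1 j).erase i).erase l, sg m := by
      rw [← nsmul_eq_mul]
      exact Finset.card_nsmul_le_sum _ _ _
        (fun l hl => h4 l (Finset.mem_of_mem_erase (Finset.mem_of_mem_erase hl)))
    rw [Finset.card_erase_of_mem hl', Finset.card_erase_of_mem hi, Nat.card_Icc] at this
    have hj1 : 2 ≤ j := by simp at hi hl; omega
    have e : j + 1 - 1 - 1 - 1 = j - 2 := by omega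
    rw [e] at this
    push_cast [Nat.cast_sub hj1] at this
    linarith
  have hall : (j : ℚ) ≤ ∑ i ∈ Finset.Icc 1 j, sg i := by
    have : (((Finset.Icc 1 j)).card : ℚ) * 1 ≤ ∑ l ∈ (Finset.Icc 1 j), sg l := by
      rw [← nsmul_eq_mul]
      exact Finset.card_nsmul_le_sum _ _ _ h4
    simpa using this
  rcases hjk.eq_or_lt with rfl | hlt
  · refine ⟨hall, fun hle => ⟨rfl, fun hk => ?_⟩⟩
    have hm : j ∈ Finset.Icc 1 j := by simp; omega
    by_contra hne
    have : 2 ≤ S j := by have := h1 j hm; have := h1' j hm; omega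
    have := h5 j hm this
    have := hrest j hm
    linarith
  ·
    suffices hstrict : (k : ℚ) < ∑ i ∈ Finset.Icc 1 j, sg i from
      ⟨hstrict.le, fun h => absurd h (not_le.2 hstrict)⟩
    obtain ⟨r, rfl⟩ : ∃ r, k = j + r := ⟨k - j, by omega⟩
    have hr : 1 ≤ r := by omega
    have htot := totient_pow_sum p j hp
    have hex : ∃ i ∈ Finset.Icc 1 j, p ^ r + 1 ≤ SP i := by
      by_contra hcon
      push Not at hcon
      have : ∑ i ∈ Finset.Icc 1 j, (p ^ i).totient * SP i ≤
          ∑ i ∈ Finset.Icc 1 j, (p ^ i).totient * p ^ r :=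
        Finset.sum_le_sum (fun i hi => Nat.mul_le_mul_left _ (by have := hcon i hi; omega))
      rw [← Finset.sum_mul] at this
      have hpr : 1 < p ^ r := Nat.one_lt_pow (by omega) hp.one_lt
      have : p ^ (j + r) = p ^ j * p ^ r := pow_add _ _ _
      rw [← htot] at this
      nlinarith
    obtain ⟨i, hi, hSi⟩ := hex
    have hi' := Finset.mem_Icc.1 hi
    by_cases hgood : p = 3 → S i ≠ 5 ∧ S i ≠ 6
    · have := h6 i hi r hr (hSi.trans (h1' i hi)) hgood
      have := hrest i hi
      push_cast
      linarith
    · push Not at hgood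
      obtain ⟨rfl, h56⟩ := hgood
      have hS56 : S i = 5 ∨ S i = 6 := by
        by_cases h : S i = 5
        · exact Or.inl h
        · exact Or.inr (h56 h)
      have hle6 : SP i ≤ 6 := by have := h1' i hi; omega
      have hr1 : r = 1 := by
        by_contra hne
        have : 3 ^ 2 ≤ 3 ^ r := Nat.pow_le_pow_right (by norm_num) (by omega)
        omega
      subst hr1
      by_contra hcon
      push Not at hcon
      have hi53 := h5 i hi (by omega)
      have hothers : ∀ l ∈ Finset.Icc 1 j, l ≠ i → SP l = 1 := by
        intro l hl hli
        by_contra hne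
        have : 2 ≤ S l := by have := h1 l hl; have := h1' l hl; omega
        have := h5 l hl this
        have := hrest2 i hi l hl hli
        push_cast at hcon
        linarith
      have e1 := Finset.add_sum_erase (Finset.Icc 1 j) (fun i => (3 ^ i).totient * SP i) hi
      have e2 := Finset.add_sum_erase (Finset.Icc 1 j) (fun i => (3 ^ i).totient) hi
      have e3 : ∑ x ∈ (Finset.Icc 1 j).erase i, (3 ^ x).totient * SP x =
          ∑ x ∈ (Finset.Icc 1 j).erase i, (3 ^ x).totient := by
        apply Finset.sum_congr rfl
        intro l hl
        rw [hothers l (Finset.mem_of_mem_erase hl) (Finset.ne_of_mem_erase hl), mul_one]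
      rw [e3] at e1
      have hmod := h3 i hi
      obtain ⟨i, rfl⟩ : ∃ m, i = m + 1 := ⟨i - 1, by omega⟩
      obtain ⟨d, rfl⟩ : ∃ d, j = i + 1 + d := ⟨j - (i + 1), by omega⟩
      have e4 : (3 ^ (i + 1)).totient = 3 ^ i * 2 := by
        rw [Nat.totient_prime_pow_succ Nat.prime_three]
      rw [e4] at e1 e2
      have e5 : 3 ^ i * (2 * SP (i + 1)) = 3 ^ i * (2 + 2 * 3 ^ (d + 1)) := by
        have p1 : 3 ^ (i + 1 + d + 1) = 3 * 3 ^ (i + 1 + d) := by ring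
        have p2 : 3 ^ i * 3 ^ (d + 1) = 3 ^ (i + 1 + d) := by ring
        nlinarith
      have e6 := Nat.eq_of_mul_eq_mul_left (by positivity) e5
      have e7 : 3 ^ (d + 1) = 3 * 3 ^ d := by ring
      rw [Nat.ModEq] at hmod
      omega

theorem isCyclic_map' {G H : Type*} [Group G] [Group H] (f : G →* H) (U : Subgroup G)
    (h : IsCyclic U) : IsCyclic (U.map f) :=
  isCyclic_of_surjective (f.subgroupMap U) (f.subgroupMap_surjective U)

open Classical in
theorem sum_zpowers_s13 (G : Type*) [Group G] [Fintype G] (h : Subgroup G → ℚ) :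
    ∑ x : G, h (Subgroup.zpowers x) =
      ∑ U ∈ (Finset.univ : Finset (Subgroup G)).filter (fun U : Subgroup G => IsCyclic U), ((Nat.card U).totient : ℚ) * h U := by
  have hmaps : ∀ x ∈ (Finset.univ : Finset G), Subgroup.zpowers x ∈
      (Finset.univ : Finset (Subgroup G)).filter (fun U : Subgroup G => IsCyclic U) := by
    intro x _
    simp only [Finset.mem_filter, Finset.mem_univ, true_and]
    infer_instance
  rw [← Finset.sum_fiberwise_of_maps_to hmaps]
  apply Finset.sum_congr rfl
  intro U hU
  have hU' : IsCyclic U := by simpa using hU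
  rw [Finset.sum_congr rfl (g := fun _ => h U) (by
    intro x hx
    rw [(Finset.mem_filter.1 hx).2])]
  rw [Finset.sum_const, nsmul_eq_mul]
  congr 2
  have := IsCyclic.card_orderOf_eq_totient (α := U) (d := Nat.card U)
    (by rw [Nat.card_eq_fintype_card])
  rw [← this]
  symm
  apply Finset.card_bij (fun (x : U) _ => (x : G))
  · intro x hx
    simp only [Finset.mem_filter, Finset.mem_univ, true_and] at hx ⊢
    apply Subgroup.eq_of_le_of_card_ge
    · simp
    · rw [Nat.card_zpowers, Subgroup.orderOf_coe, hx]
  · intro a _ b _ hab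
    exact Subtype.ext hab
  · intro x hx
    simp only [Finset.mem_filter, Finset.mem_univ, true_and] at hx
    have hxU : x ∈ U := hx ▸ Subgroup.mem_zpowers x
    refine ⟨⟨x, hxU⟩, ?_, rfl⟩
    simp only [Finset.mem_filter, Finset.mem_univ, true_and]
    rw [Subgroup.orderOf_mk, ← hx, Nat.card_zpowers]

open Classical in
noncomputable def cs {G : Type*} [Group G] [Fintype G] (K : Subgroup G) (d : ℕ) :
    Finset (Subgroup G) :=
  {U : Subgroup G | IsCyclic U ∧ Nat.card U = d ∧ U ≤ K}

theorem mem_cs {G : Type*} [Group G] [Fintype G] (K : Subgroup G) (d : ℕ) (U : Subgroup G) :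
    U ∈ cs K d ↔ IsCyclic U ∧ Nat.card U = d ∧ U ≤ K := by
  classical
  simp [cs]

open Classical in
theorem card_orderOf_cs {G : Type*} [Group G] [Fintype G] (K : Subgroup G) (d : ℕ) :
    ({x : G | orderOf x = d ∧ x ∈ K} : Finset G).card = d.totient * (cs K d).card := by
  have := sum_zpowers_s13 G (fun U => if Nat.card U = d ∧ U ≤ K then 1 else 0)
  simp only [Nat.card_zpowers, Subgroup.zpowers_le] at this
  rw [← Finset.sum_filter, Finset.sum_const, nsmul_eq_mul, mul_one] at this
  simp only [mul_ite, mul_one, mul_zero] at this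
  rw [← Finset.sum_filter, Finset.filter_filter] at this
  rw [Finset.sum_congr rfl (g := fun _ => (d.totient : ℚ)) (by
    intro U hU
    simp only [Finset.mem_filter, Finset.mem_univ, true_and] at hU
    rw [hU.2.1])] at this
  rw [Finset.sum_const, nsmul_eq_mul, mul_comm] at this
  unfold cs
  exact_mod_cast this

theorem index_normalizer_le {G : Type*} [Group G] [Fintype G] (x : G) :
    (Subgroup.normalizer (Subgroup.zpowers x : Set G)).index ≤ (cs (⊤ : Subgroup G) (orderOf x)).card := by
  classical
  set N := Subgroup.normalizer (Subgroup.zpowers x : Set G) with hN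
  let F : G ⧸ N → (cs (⊤ : Subgroup G) (orderOf x)) := fun c =>
    ⟨(Subgroup.zpowers x).map (MulAut.conj c.out).toMonoidHom, by
      rw [mem_cs]
      refine ⟨isCyclic_map' _ _ inferInstance, ?_, le_top⟩
      rw [Subgroup.card_map_of_injective (MulAut.conj c.out).injective, Nat.card_zpowers]⟩
  have hF : Function.Injective F := by
    intro c c' hcc
    have h1 : (Subgroup.zpowers x).map (MulAut.conj c.out).toMonoidHom =
      (Subgroup.zpowers x).map (MulAut.conj c'.out).toMonoidHom := congrArg Subtype.val hcc
    rw [← c.out_eq, ← c'.out_eq]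
    change (QuotientGroup.mk c.out : G ⧸ N) = QuotientGroup.mk c'.out
    rw [QuotientGroup.eq]
    apply Subgroup.mem_normalizer_iff.2
    intro h
    have key : ∀ (g y : G), y ∈ Subgroup.zpowers x ↔
        g * y * g⁻¹ ∈ (Subgroup.zpowers x).map (MulAut.conj g).toMonoidHom := by
      intro g y
      constructor
      · intro hy
        exact ⟨y, hy, by simp⟩
      · rintro ⟨z, hz, hz'⟩
        have : z = y := by simpa using hz'
        exact this ▸ hz
    rw [key c'.out h, ← h1, key c.out (_ * h * _)]
    apply iff_of_eq
    congr 1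
    group
  have := Nat.card_le_card_of_injective F hF
  simpa [Subgroup.index] using this

theorem cs_modEq {G : Type*} [Group G] [Fintype G] {p : ℕ} [Fact p.Prime] (P : Sylow p G) (i : ℕ) :
    (cs (⊤ : Subgroup G) (p ^ i)).card ≡ (cs (P : Subgroup G) (p ^ i)).card [MOD p] := by
  classical
  let X := {U : Subgroup G // (IsCyclic U ∧ Nat.card U = p ^ i) ∧ ¬ U ≤ P}
  let act : MulAction P X :=
    { smul := fun g U => ⟨U.1.map (MulAut.conj (g : G)).toMonoidHom, by
        obtain ⟨U, ⟨hc, hU⟩, hnot⟩ := U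
        refine ⟨⟨isCyclic_map' _ _ hc, ?_⟩, ?_⟩
        · rw [Subgroup.card_map_of_injective (MulAut.conj (g : G)).injective]; exact hU
        · intro hle
          apply hnot
          intro y hy
          have : (g : G) * y * (g : G)⁻¹ ∈ (P : Subgroup G) := hle ⟨y, hy, by simp⟩
          have h2 := P.mul_mem (P.mul_mem (P.inv_mem g.2) this) g.2
          simpa [mul_assoc] using h2⟩
      one_smul := by
        intro U
        apply Subtype.ext
        change U.1.map (MulAut.conj ((1 : P) : G)).toMonoidHom = U.1
        ext y
        simp [Subgroup.mem_map]
      mul_smul := by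
        intro a b U
        apply Subtype.ext
        change U.1.map (MulAut.conj ((a * b : P) : G)).toMonoidHom =
          (U.1.map (MulAut.conj (b : G)).toMonoidHom).map (MulAut.conj (a : G)).toMonoidHom
        rw [Subgroup.map_map]
        congr 1
        ext y
        simp [mul_assoc] }
  have hmod := P.2.card_modEq_card_fixedPoints X
  have hempty : IsEmpty (MulAction.fixedPoints P X) := by
    constructor
    rintro ⟨⟨U, ⟨hc, hU⟩, hnot⟩, hfix⟩
    apply hnot
    have hnorm : (P : Subgroup G) ≤ Subgroup.normalizer (U : Set G) := by
      intro g hg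
      have hkey : ∀ g ∈ (P : Subgroup G), ∀ y ∈ U, g * y * g⁻¹ ∈ U := by
        intro g hg y hy
        have h1 := congrArg Subtype.val (hfix ⟨g, hg⟩)
        change U.map (MulAut.conj (g : G)).toMonoidHom = U at h1
        rw [← h1]
        exact ⟨y, hy, by simp⟩
      rw [Subgroup.mem_normalizer_iff]
      intro y
      refine ⟨hkey g hg y, fun hy => ?_⟩
      have := hkey g⁻¹ (inv_mem hg) _ hy
      simpa [mul_assoc] using this
    have hsup : IsPGroup p ((P : Subgroup G) ⊔ U : Subgroup G) :=
      IsPGroup.to_sup_of_normal_right' P.2 (IsPGroup.of_card hU) hnorm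
    have := P.3 hsup le_sup_left
    exact this ▸ le_sup_right
  rw [Nat.card_of_isEmpty (α := MulAction.fixedPoints P X)] at hmod
  have hX : Nat.card X = (cs (⊤ : Subgroup G) (p ^ i)).card - (cs (P : Subgroup G) (p ^ i)).card := by
    rw [← Finset.card_sdiff_of_subset, Nat.card_eq_fintype_card, Fintype.card_subtype]
    · congr 1
      ext U
      simp only [Finset.mem_filter, Finset.mem_univ, true_and, Finset.mem_sdiff, mem_cs]
      constructor
      · rintro ⟨⟨a, b⟩, c⟩; exact ⟨⟨a, b, le_top⟩, fun h => c h.2.2⟩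
      · rintro ⟨⟨a, b, _⟩, c⟩; exact ⟨⟨a, b⟩, fun h => c ⟨a, b, h⟩⟩
    · intro U
      simp only [mem_cs]
      rintro ⟨a, b, c⟩; exact ⟨a, b, le_top⟩
  have hle : (cs (P : Subgroup G) (p ^ i)).card ≤ (cs (⊤ : Subgroup G) (p ^ i)).card := by
    apply Finset.card_le_card
    intro U
    simp only [mem_cs]
    rintro ⟨a, b, c⟩; exact ⟨a, b, le_top⟩
  rw [hX] at hmod
  have := hmod.add_right ((cs (P : Subgroup G) (p ^ i)).card)
  rwa [Nat.sub_add_cancel hle, zero_add] at this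

noncomputable def idx {G : Type*} [Group G] (x : G) : ℕ :=
  (Subgroup.normalizer (Subgroup.zpowers x : Set G)).index

noncomputable def WW {G : Type*} [Group G] (p : ℕ) (x : G) : ℚ :=
  1 / ((orderOf x).totient * ff 1 (p + 1) (idx x))

open Classical in
theorem level_ge {G : Type*} [Group G] [Fintype G] (p d : ℕ) (hd : 0 < d) (c : ℚ)
    (hS : 1 ≤ (cs (⊤ : Subgroup G) d).card)
    (h : ∀ s, s ≠ 0 → s ≤ (cs (⊤ : Subgroup G) d).card →
      (ff 1 (p + 1) s : ℚ) * c ≤ (cs (⊤ : Subgroup G) d).card) :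
    c ≤ ∑ x : G with orderOf x = d, WW p x := by
  have hcard := card_orderOf_cs (⊤ : Subgroup G) d
  simp only [Subgroup.mem_top, and_true] at hcard
  set S := (cs (⊤ : Subgroup G) d).card with hSdef
  have hφ : (0 : ℚ) < d.totient := by exact_mod_cast Nat.totient_pos.2 hd
  have hSq : (0 : ℚ) < S := by exact_mod_cast hS
  have hterm : ∀ x ∈ ({x : G | orderOf x = d} : Finset G), c / (d.totient * S) ≤ WW p x := by
    intro x hx
    have hx' : orderOf x = d := by simpa using hx
    have hne : idx x ≠ 0 := Subgroup.index_ne_zero_of_finite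
    have hle : idx x ≤ S := by
      have := index_normalizer_le x
      rw [hx'] at this
      exact this
    have hh := h _ hne hle
    have hf : (0 : ℚ) < ff 1 (p + 1) (idx x) := by
      exact_mod_cast ff_pos 0 (p + 1) (idx x) hne
    unfold WW
    rw [hx', div_le_div_iff₀ (by positivity) (by positivity)]
    nlinarith
  have := Finset.card_nsmul_le_sum _ _ _ hterm
  rw [hcard, nsmul_eq_mul] at this
  refine le_trans (le_of_eq ?_) this
  push_cast
  field_simp

open Classical in
theorem level_gt {G : Type*} [Group G] [Fintype G] (p d : ℕ) (hd : 0 < d) (c : ℕ)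
    (hS : 1 ≤ (cs (⊤ : Subgroup G) d).card)
    (h : ∀ s, s ≠ 0 → s ≤ (cs (⊤ : Subgroup G) d).card →
      ff 1 (p + 1) s * c < (cs (⊤ : Subgroup G) d).card) :
    (c : ℚ) < ∑ x : G with orderOf x = d, WW p x := by
  set S := (cs (⊤ : Subgroup G) d).card with hSdef
  have hSq : (0 : ℚ) < S := by exact_mod_cast hS
  have hb : ∀ s, s ≠ 0 → s ≤ S → ff 1 (p + 1) s ≤ ∑ s ∈ Finset.range (S + 1), ff 1 (p + 1) s := by
    intro s _ hs
    exact Finset.single_le_sum (f := fun s => ff 1 (p + 1) s) (fun _ _ => Nat.zero_le _)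
      (Finset.mem_range.2 (by omega))
  set B := ∑ s ∈ Finset.range (S + 1), ff 1 (p + 1) s with hB
  have hBpos : (0 : ℚ) < B := by
    have h1 := hb 1 one_ne_zero hS
    have h2 := ff_pos 0 (p + 1) 1 one_ne_zero
    exact_mod_cast lt_of_lt_of_le h2 h1
  have := level_ge (G := G) p d hd (c + 1 / B) hS (by
    intro s hs hsS
    have h1 : ((ff 1 (p + 1) s * c + 1 : ℕ) : ℚ) ≤ S := by exact_mod_cast h s hs hsS
    have h2 : (ff 1 (p + 1) s : ℚ) ≤ B := by exact_mod_cast hb s hs hsS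
    have h3 : (ff 1 (p + 1) s : ℚ) * (1 / B) ≤ 1 := by
      rw [mul_one_div, div_le_one hBpos]; exact h2
    push_cast at h1
    rw [mul_add]
    linarith)
  have : (0 : ℚ) < 1 / B := by positivity
  linarith

open Classical in
theorem key_lemma {G : Type*} [Group G] [Fintype G] (p : ℕ) [hpf : Fact p.Prime] (hp3 : 3 ≤ p) :
    (((Nat.card G).factorization p : ℕ) : ℚ) ≤
        ∑ x : G with (x ≠ 1 ∧ ∃ i, orderOf x = p ^ i), WW p x ∧
      (∑ x : G with (x ≠ 1 ∧ ∃ i, orderOf x = p ^ i), WW p x ≤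
          (((Nat.card G).factorization p : ℕ) : ℚ) →
        ∀ Q : Sylow p G, IsCyclic Q ∧ (Q : Subgroup G).Normal) := by
  have hp := hpf.out
  set k := (Nat.card G).factorization p with hk
  have hn : Nat.card G ≠ 0 := Nat.card_pos.ne'
  have hord : ∀ (x : G) i, orderOf x = p ^ i → i ≤ k := by
    intro x i hx
    exact (hp.pow_dvd_iff_le_factorization hn).1 (hx ▸ orderOf_dvd_natCard x)
  obtain ⟨j, hjk, ⟨x0, hx0⟩, hjmax⟩ : ∃ j ≤ k, (∃ x : G, orderOf x = p ^ j) ∧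
      ∀ (x : G) i, orderOf x = p ^ i → i ≤ j := by
    refine ⟨Nat.findGreatest (fun i => ∃ x : G, orderOf x = p ^ i) k, Nat.findGreatest_le _,
      Nat.findGreatest_spec (P := fun i => ∃ x : G, orderOf x = p ^ i) (Nat.zero_le k)
        ⟨1, by simp⟩, ?_⟩
    intro x i hx
    exact Nat.le_findGreatest (hord x i hx) ⟨x, hx⟩
  have hj0 : k ≠ 0 → j ≠ 0 := by
    intro hk0 hj0
    have hpd : p ∣ Nat.card G := Nat.dvd_of_factorization_pos hk0
    obtain ⟨x, hx⟩ := exists_prime_orderOf_dvd_card' p hpd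
    have := hjmax x 1 (by simpa using hx)
    omega
  have hpz : IsPGroup p (Subgroup.zpowers x0) :=
    IsPGroup.of_card (by rw [Nat.card_zpowers, hx0])
  obtain ⟨P, hP⟩ := hpz.exists_le_sylow
  have hx0P : x0 ∈ (P : Subgroup G) := hP (Subgroup.mem_zpowers x0)
  have hPcard : Nat.card P = p ^ k := P.card_eq_multiplicity
  have hSP1 : ∀ i ∈ Finset.Icc 1 j, 1 ≤ (cs (P : Subgroup G) (p ^ i)).card := by
    intro i hi
    rw [Finset.mem_Icc] at hi
    rw [Nat.one_le_iff_ne_zero, Finset.card_ne_zero]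
    refine ⟨Subgroup.zpowers (x0 ^ p ^ (j - i)), ?_⟩
    rw [mem_cs]
    refine ⟨inferInstance, ?_, ?_⟩
    · rw [Nat.card_zpowers, orderOf_pow_of_dvd (pow_ne_zero _ hp.ne_zero)
        (by rw [hx0]; exact pow_dvd_pow _ (by omega)), hx0, Nat.pow_div (by omega) hp.pos]
      congr 1; omega
    · rw [Subgroup.zpowers_le]; exact pow_mem hx0P _
  have hSPS : ∀ i, (cs (P : Subgroup G) (p ^ i)).card ≤ (cs (⊤ : Subgroup G) (p ^ i)).card := by
    intro i
    apply Finset.card_le_card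
    intro U
    simp only [mem_cs]
    rintro ⟨a, b, c⟩; exact ⟨a, b, le_top⟩
  have hfib : ∀ x : G, x ≠ 1 → (∃ i, orderOf x = p ^ i) →
      (orderOf x).factorization p ∈ Finset.Icc 1 j ∧
      orderOf x = p ^ ((orderOf x).factorization p) := by
    rintro x hx1 ⟨i, hi⟩
    have : (orderOf x).factorization p = i := by
      rw [hi, Nat.factorization_pow_self hp]
    rw [this]
    refine ⟨Finset.mem_Icc.2 ⟨?_, hjmax x i hi⟩, hi⟩
    rcases Nat.eq_zero_or_pos i with rfl | h
    · exact absurd (orderOf_eq_one_iff.1 (by simpa using hi)) hx1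
    · exact h
  have hne1 : ∀ (x : G) i, 1 ≤ i → orderOf x = p ^ i → x ≠ 1 := by
    rintro x i hi hx rfl
    rw [orderOf_one] at hx
    have := Nat.one_lt_pow (n := i) (by omega) hp.one_lt
    omega
  have hcount : ∑ i ∈ Finset.Icc 1 j, (p ^ i).totient * (cs (P : Subgroup G) (p ^ i)).card + 1
      = p ^ k := by
    have hmaps : ∀ x ∈ ({x : G | x ≠ 1 ∧ x ∈ (P : Subgroup G)} : Finset G),
        (orderOf x).factorization p ∈ Finset.Icc 1 j := by
      intro x hx
      simp only [Finset.mem_filter, Finset.mem_univ, true_and] at hx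
      obtain ⟨i, hi⟩ := (IsPGroup.iff_orderOf.1 P.2) ⟨x, hx.2⟩
      rw [Subgroup.orderOf_mk] at hi
      exact (hfib x hx.1 ⟨i, hi⟩).1
    have h1 := Finset.card_eq_sum_card_fiberwise hmaps
    have h2 : ∀ i ∈ Finset.Icc 1 j,
        (({x : G | x ≠ 1 ∧ x ∈ (P : Subgroup G)} : Finset G).filter
          (fun x => (orderOf x).factorization p = i)).card =
        (p ^ i).totient * (cs (P : Subgroup G) (p ^ i)).card := by
      intro i hi
      rw [← card_orderOf_cs]
      congr 1
      ext x
      simp only [Finset.mem_filter, Finset.mem_univ, true_and]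
      constructor
      · rintro ⟨⟨hx1, hxP⟩, hxi⟩
        obtain ⟨i', hi'⟩ := (IsPGroup.iff_orderOf.1 P.2) ⟨x, hxP⟩
        rw [Subgroup.orderOf_mk] at hi'
        have := (hfib x hx1 ⟨i', hi'⟩).2
        rw [hxi] at this
        exact ⟨this, hxP⟩
      · rintro ⟨hxi, hxP⟩
        refine ⟨⟨hne1 x i (Finset.mem_Icc.1 hi).1 hxi, hxP⟩, ?_⟩
        rw [hxi, Nat.factorization_pow_self hp]
    rw [Finset.sum_congr rfl h2] at h1
    rw [← h1, ← hPcard]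
    have h3 : ({x : G | x ≠ 1 ∧ x ∈ (P : Subgroup G)} : Finset G) =
        ({x : G | x ∈ (P : Subgroup G)} : Finset G).erase 1 := by
      ext x
      simp
    rw [h3, Finset.card_erase_add_one (by simp [one_mem])]
    rw [Nat.card_eq_fintype_card]
    exact (Fintype.card_subtype _).symm
  have htotal : ∑ x : G with (x ≠ 1 ∧ ∃ i, orderOf x = p ^ i), WW p x =
      ∑ i ∈ Finset.Icc 1 j, ∑ x : G with orderOf x = p ^ i, WW p x := by
    have hmaps : ∀ x ∈ ({x : G | x ≠ 1 ∧ ∃ i, orderOf x = p ^ i} : Finset G),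
        (orderOf x).factorization p ∈ Finset.Icc 1 j := by
      intro x hx
      simp only [Finset.mem_filter, Finset.mem_univ, true_and] at hx
      exact (hfib x hx.1 hx.2).1
    rw [← Finset.sum_fiberwise_of_maps_to hmaps]
    apply Finset.sum_congr rfl
    intro i hi
    apply Finset.sum_congr _ (fun _ _ => rfl)
    ext x
    simp only [Finset.mem_filter, Finset.mem_univ, true_and]
    constructor
    · rintro ⟨⟨hx1, hxP⟩, hxi⟩
      have := (hfib x hx1 hxP).2
      rwa [hxi] at this
    · intro hxi
      refine ⟨⟨hne1 x i (Finset.mem_Icc.1 hi).1 hxi, i, hxi⟩, ?_⟩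
      rw [hxi, Nat.factorization_pow_self hp]
  have hanti : ∀ s, ff 1 (p + 1) s ≤ ff 1 4 s := fun s => ff_anti 1 4 (p + 1) s (by omega)
  have hS1 : ∀ i ∈ Finset.Icc 1 j, 1 ≤ (cs (⊤ : Subgroup G) (p ^ i)).card :=
    fun i hi => (hSP1 i hi).trans (hSPS i)
  have hppos : ∀ i, 0 < p ^ i := fun i => pow_pos hp.pos i
  have hcore := numeric_core p j k hp hp3 hjk hj0 (fun i => (cs (⊤ : Subgroup G) (p ^ i)).card)
    (fun i => (cs (P : Subgroup G) (p ^ i)).card)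
    (fun i => ∑ x : G with orderOf x = p ^ i, WW p x) hSP1 (fun i _ => hSPS i) hcount
    (fun i _ => cs_modEq P i)
    (by
      intro i hi
      apply level_ge p (p ^ i) (hppos i) 1 (hS1 i hi)
      intro s hs hsS
      rw [mul_one]
      exact_mod_cast (hanti s).trans (ff_bound_B s _ hs hsS))
    (by
      intro i hi h2
      apply level_ge p (p ^ i) (hppos i) _ (hS1 i hi)
      intro s hs hsS
      have h1 := ff_bound_C s _ hs hsS h2
      have h2 := hanti s
      have h3 : 5 * ff 1 (p + 1) s ≤ 3 * (cs (⊤ : Subgroup G) (p ^ i)).card := by omega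
      have h4 : (5 : ℚ) * ff 1 (p + 1) s ≤ 3 * (cs (⊤ : Subgroup G) (p ^ i)).card := by
        exact_mod_cast h3
      linarith)
    (by
      intro i hi r hr hS h56
      have := level_gt (G := G) p (p ^ i) (hppos i) (r + 1) (hS1 i hi) (by
        intro s hs hsS
        have h3r : 3 ^ r ≤ p ^ r := Nat.pow_le_pow_left hp3 r
        by_cases hbad : (cs (⊤ : Subgroup G) (p ^ i)).card = 5 ∨
            (cs (⊤ : Subgroup G) (p ^ i)).card = 6
        · have hpne : p ≠ 3 := by
            intro h3
            have := h56 h3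
            omega
          have hp5 : 5 ≤ p := by
            have : p ≠ 4 := by rintro rfl; revert hp; decide
            omega
          have hr1 : r = 1 := by
            by_contra hne
            have : 3 ^ 2 ≤ 3 ^ r := Nat.pow_le_pow_right (by norm_num) (by omega)
            omega
          have h6 := ff_small1' s (by omega)
          have h7 := ff_anti 1 6 (p + 1) s (by omega)
          subst hr1
          omega
        · push Not at hbad
          have h1 := ff_bound_A s _ r hs hsS hr (by omega) hbad.1 hbad.2
          calc ff 1 (p + 1) s * (r + 1) ≤ ff 1 4 s * (r + 1) := Nat.mul_le_mul_right _ (hanti s)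
            _ = (r + 1) * ff 1 4 s := mul_comm _ _
            _ < _ := h1)
      exact_mod_cast this)
  rw [htotal]
  refine ⟨hcore.1, fun hle Q => ?_⟩
  obtain ⟨hjk', hSk⟩ := hcore.2 hle
  have hSk1 : (cs (⊤ : Subgroup G) (p ^ k)).card ≤ 1 := by
    by_cases hk0 : k = 0
    · rw [hk0, pow_zero, Finset.card_le_one]
      intro U hU V hV
      rw [mem_cs] at hU hV
      rw [Subgroup.card_eq_one.1 hU.2.1, Subgroup.card_eq_one.1 hV.2.1]
    · exact (hSk hk0).le
  have hPc : IsCyclic P := by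
    have : (P : Subgroup G) = Subgroup.zpowers x0 := by
      symm
      apply Subgroup.eq_of_le_of_card_ge hP
      rw [Nat.card_zpowers, hx0, hjk']
      exact hPcard.le
    change IsCyclic (P : Subgroup G)
    rw [this]
    infer_instance
  have hQc : IsCyclic Q := isCyclic_of_surjective (Sylow.equiv P Q) (Sylow.equiv P Q).surjective
  refine ⟨hQc, ⟨?_⟩⟩
  intro y hy g
  have hQcard : Nat.card Q = p ^ k := Q.card_eq_multiplicity
  have hmem1 : (Q : Subgroup G) ∈ cs (⊤ : Subgroup G) (p ^ k) := by
    rw [mem_cs]; exact ⟨hQc, hQcard, le_top⟩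
  have hmem2 : (Q : Subgroup G).map (MulAut.conj g).toMonoidHom ∈
      cs (⊤ : Subgroup G) (p ^ k) := by
    rw [mem_cs]
    refine ⟨isCyclic_map' _ _ hQc, ?_, le_top⟩
    rw [Subgroup.card_map_of_injective (MulAut.conj g).injective]
    exact hQcard
  rw [Finset.card_le_one.1 hSk1 _ hmem1 _ hmem2]
  exact ⟨y, hy, by simp⟩

theorem card_dvd_centralizer {G : Type*} [Group G] [Finite G] (x : G) :
    Nat.card G ∣ Nat.card (Subgroup.centralizer {x}) * (orderOf x).totient * idx x := by
  have hc : Subgroup.centralizer ((Subgroup.zpowers x : Subgroup G) : Set G) =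
      Subgroup.centralizer {x} := by
    rw [Subgroup.zpowers_eq_closure, Subgroup.centralizer_closure]
  have hle : Subgroup.centralizer ((Subgroup.zpowers x : Subgroup G) : Set G) ≤
      Subgroup.normalizer (Subgroup.zpowers x : Set G) := Subgroup.centralizer_le_normalizer _
  have h1 := Subgroup.card_mul_index (Subgroup.zpowers x).normalizerMonoidHom.ker
  rw [Subgroup.index_ker, Subgroup.normalizerMonoidHom_ker,
    Nat.card_congr (Subgroup.subgroupOfEquivOfLe hle).toEquiv, hc] at h1
  have h2 := Subgroup.card_subgroup_dvd_card (Subgroup.zpowers x).normalizerMonoidHom.range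
  rw [IsCyclic.card_mulAut, Nat.card_zpowers] at h2
  rw [← Subgroup.card_mul_index (Subgroup.normalizer (Subgroup.zpowers x : Set G)), ← h1]
  exact Nat.mul_dvd_mul (Nat.mul_dvd_mul_left _ h2) (dvd_refl _)

noncomputable def AA (t q : ℕ) (G : Type*) [Group G] [Fintype G] : ℚ :=
  ∑ x : G with Rough q (orderOf x),
    ((t + (orderOf x).primeFactors.card : ℕ) : ℚ) / (orderOf x).totient

theorem rough_coprime {p i b : ℕ} (hp : p.Prime) (h : Rough (p + 1) b) (hb : b ≠ 0) :
    (p ^ i).Coprime b := by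
  apply Nat.Coprime.pow_left
  rw [hp.coprime_iff_not_dvd]
  intro hd
  have := h p (Nat.mem_primeFactors.2 ⟨hp, hd, hb⟩)
  omega

theorem rough_coprime_totient {p i b : ℕ} (hp : p.Prime) (h : Rough (p + 1) b) (hb : b ≠ 0) :
    b.Coprime (p ^ i).totient := by
  rcases Nat.eq_zero_or_pos i with rfl | hi
  · simp
  rw [Nat.totient_prime_pow hp hi]
  apply Nat.Coprime.mul_right
  · exact (rough_coprime hp h hb).symm
  · apply Nat.Coprime.symm
    apply Nat.Coprime.symm
    apply Nat.coprime_of_dvd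
    intro k hk hkb hkp
    have h1 := h k (Nat.mem_primeFactors.2 ⟨hk, hkb, hb⟩)
    have h2 := Nat.le_of_dvd (by have := hp.two_le; omega) hkp
    omega

theorem pair_inj {G : Type*} [Group G] [Finite G] {p : ℕ} (hp : p.Prime) {u u' y y' : G}
    (hu : ∃ i, orderOf u = p ^ i) (hu' : ∃ i, orderOf u' = p ^ i)
    (hc : Commute u y) (hc' : Commute u' y')
    (hy : Rough (p + 1) (orderOf y)) (hy' : Rough (p + 1) (orderOf y'))
    (h : u * y = u' * y') : u = u' := by
  obtain ⟨i, hi⟩ := hu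
  obtain ⟨j, hj⟩ := hu'
  have hy0 : orderOf y ≠ 0 := (orderOf_pos y).ne'
  have hy0' : orderOf y' ≠ 0 := (orderOf_pos y').ne'
  have hcop : (p ^ (i + j)).Coprime (orderOf y * orderOf y') :=
    Nat.Coprime.mul_right (rough_coprime hp hy hy0) (rough_coprime hp hy' hy0')
  obtain ⟨m, hm1, hm2⟩ := Nat.chineseRemainder hcop 1 0
  have e1 : u ^ m = u := by
    conv_rhs => rw [← pow_one u]
    rw [pow_eq_pow_iff_modEq, hi]
    exact hm1.of_dvd (pow_dvd_pow p (by omega))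
  have e2 : u' ^ m = u' := by
    conv_rhs => rw [← pow_one u']
    rw [pow_eq_pow_iff_modEq, hj]
    exact hm1.of_dvd (pow_dvd_pow p (by omega))
  have e3 : y ^ m = 1 := by
    rw [← pow_zero y, pow_eq_pow_iff_modEq]
    exact hm2.of_dvd (Dvd.intro _ rfl)
  have e4 : y' ^ m = 1 := by
    rw [← pow_zero y', pow_eq_pow_iff_modEq]
    exact hm2.of_dvd (Dvd.intro_left _ rfl)
  have := congrArg (· ^ m) h
  simp only [hc.mul_pow, hc'.mul_pow, e1, e2, e3, e4, mul_one] at this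
  exact this

open Classical in
theorem AA_ge (t p : ℕ) (hp : p.Prime) (G : Type*) [Group G] [Fintype G] :
    AA t (p + 1) G + ∑ u : G with (u ≠ 1 ∧ ∃ i, orderOf u = p ^ i),
      1 / ((orderOf u).totient : ℚ) * AA (t + 1) (p + 1) (Subgroup.centralizer {u}) ≤ AA t p G := by
  have hsplit : AA t p G = AA t (p + 1) G +
      ∑ x : G with (Rough p (orderOf x) ∧ ¬ Rough (p + 1) (orderOf x)),
        ((t + (orderOf x).primeFactors.card : ℕ) : ℚ) / (orderOf x).totient := by
    unfold AA
    rw [← Finset.sum_filter_add_sum_filter_not _ (fun x : G => Rough (p + 1) (orderOf x)),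
      Finset.filter_filter, Finset.filter_filter]
    congr 1
    apply Finset.sum_congr _ (fun _ _ => rfl)
    ext x
    simp only [Finset.mem_filter, Finset.mem_univ, true_and, and_iff_right_iff_imp]
    intro h r hr
    have := h r hr
    omega
  rw [hsplit]
  gcongr
  unfold AA
  simp only [Finset.mul_sum]
  rw [Finset.sum_sigma']
  set T := (Finset.univ.filter (fun u : G => u ≠ 1 ∧ ∃ i, orderOf u = p ^ i)).sigma
    (fun u => Finset.univ.filter (fun y : Subgroup.centralizer {u} => Rough (p + 1) (orderOf y))) with hT
  have hTm : ∀ z ∈ T, (z.1 ≠ 1 ∧ ∃ i, orderOf z.1 = p ^ i) ∧ Commute z.1 (z.2 : G) ∧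
      Rough (p + 1) (orderOf (z.2 : G)) := by
    intro z hz
    simp only [hT, Finset.mem_sigma, Finset.mem_filter, Finset.mem_univ, true_and] at hz
    refine ⟨hz.1, ?_, ?_⟩
    · exact (Subgroup.mem_centralizer_singleton_iff.1 z.2.2).symm
    · rw [Subgroup.orderOf_coe]; exact hz.2
  have hinj : Set.InjOn (fun z : (Σ u : G, Subgroup.centralizer {u}) => z.1 * (z.2 : G)) T := by
    rintro ⟨u, y⟩ hz ⟨u', y'⟩ hz' h
    obtain ⟨⟨h1, h2⟩, h3, h4⟩ := hTm _ hz
    obtain ⟨⟨h1', h2'⟩, h3', h4'⟩ := hTm _ hz'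
    have : u = u' := pair_inj hp h2 h2' h3 h3' h4 h4' h
    subst this
    have : y = y' := by
      apply Subtype.ext
      simpa using h
    rw [this]
  have hord : ∀ z ∈ T, orderOf (z.1 * (z.2 : G)) = orderOf z.1 * orderOf (z.2 : G) ∧
      (orderOf z.1).Coprime (orderOf (z.2 : G)) ∧ (orderOf z.1).primeFactors = {p} := by
    intro z hz
    obtain ⟨⟨h1, i, h2⟩, h3, h4⟩ := hTm _ hz
    have hcop : (orderOf z.1).Coprime (orderOf (z.2 : G)) := by
      rw [h2]; exact rough_coprime hp h4 (orderOf_pos _).ne'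
    refine ⟨h3.orderOf_mul_eq_mul_orderOf_of_coprime hcop, hcop, ?_⟩
    rw [h2]
    apply Nat.primeFactors_prime_pow _ hp
    rintro rfl
    rw [pow_zero, orderOf_eq_one_iff] at h2
    exact h1 h2
  have heq : ∑ z ∈ T, 1 / ((orderOf z.1).totient : ℚ) *
      (((t + 1 + (orderOf z.2).primeFactors.card : ℕ) : ℚ) / (orderOf z.2).totient) =
      ∑ z ∈ T, ((t + (orderOf (z.1 * (z.2 : G))).primeFactors.card : ℕ) : ℚ) /
        (orderOf (z.1 * (z.2 : G))).totient := by
    apply Finset.sum_congr rfl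
    intro z hz
    obtain ⟨h1, h2, h3⟩ := hord z hz
    rw [h1, Nat.totient_mul h2, h2.primeFactors_mul,
      Finset.card_union_of_disjoint h2.disjoint_primeFactors, h3, Finset.card_singleton,
      Subgroup.orderOf_coe, one_div_mul_eq_div, div_div, add_assoc, Nat.cast_mul, mul_comm]
  rw [heq, ← Finset.sum_image (f := fun x : G =>
    ((t + (orderOf x).primeFactors.card : ℕ) : ℚ) / (orderOf x).totient) hinj]
  apply Finset.sum_le_sum_of_subset_of_nonneg
  · intro x hx
    obtain ⟨z, hz, rfl⟩ := Finset.mem_image.1 hx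
    obtain ⟨h1, h2, h3⟩ := hord z hz
    obtain ⟨-, -, h4⟩ := hTm z hz
    rw [Finset.mem_filter]
    refine ⟨Finset.mem_univ _, ?_⟩
    unfold Rough
    rw [h1, h2.primeFactors_mul, h3]
    constructor
    · intro r hr
      rcases Finset.mem_union.1 hr with hr | hr
      · rw [Finset.mem_singleton.1 hr]
      · have := h4 r hr; omega
    · intro h
      have := h p (by simp)
      omega
  · intros; positivity

theorem step_bound (t p : ℕ) (hp : p.Prime) {G : Type*} [Group G] [Finite G] (u : G)
    (hu : ∃ i, orderOf u = p ^ i) :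
    ff (t + 1) (p + 1) (Nat.card G) ≤
      ff (t + 1) (p + 1) (Nat.card (Subgroup.centralizer {u})) * ff 1 (p + 1) (idx u) := by
  obtain ⟨i, hi⟩ := hu
  have h0 : Nat.card (Subgroup.centralizer {u}) ≠ 0 := Nat.card_pos.ne'
  have h1 : idx u ≠ 0 := Subgroup.index_ne_zero_of_finite
  refine le_trans ?_ (ff_mul t (p + 1) _ _ h0 h1)
  apply ff_le_of_dvd _ _ _ _ (mul_ne_zero h0 h1)
  intro d hd hr
  have hd0 : d ≠ 0 := by
    rintro rfl
    exact Nat.card_pos.ne' (zero_dvd_iff.1 hd)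
  have h2 := hd.trans (card_dvd_centralizer u)
  rw [hi, mul_right_comm] at h2
  exact (rough_coprime_totient hp hr hd0).dvd_of_dvd_mul_right h2

theorem main_ind (m : ℕ) : ∀ (G : Type u) [Group G] [Fintype G] (q t : ℕ), 3 ≤ q →
    Nat.card G < q + m →
    (ff t q (Nat.card G) : ℚ) ≤ AA t q G ∧ (AA t q G ≤ ff t q (Nat.card G) →
      ∀ p, q ≤ p → Fact p.Prime → ∀ Q : Sylow p G, IsCyclic Q ∧ (Q : Subgroup G).Normal) := by
  induction m with
  | zero =>
    intro G _ _ q t hq hlt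
    have hpos : 0 < Nat.card G := Nat.card_pos
    constructor
    · have h1 : ff t q (Nat.card G) ≤ ff t q 1 := by
        apply ff_le_of_dvd _ _ _ _ one_ne_zero
        intro d hd hr
        by_contra hne
        have hne : d ≠ 1 := by simpa using hne
        obtain ⟨r, hr1, hr2⟩ := Nat.exists_prime_and_dvd hne
        have hd0 : d ≠ 0 := by rintro rfl; exact hpos.ne' (zero_dvd_iff.1 hd)
        have := hr r (Nat.mem_primeFactors.2 ⟨hr1, hr2, hd0⟩)
        have := Nat.le_of_dvd hpos (hr2.trans hd)
        omega
      have h2 : ff t q 1 = t := by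
        have hr1 : Rough q 1 := by simp [Rough]
        simp [ff, Finset.filter_singleton, hr1]
      have h3 : (t : ℚ) ≤ AA t q G := by
        unfold AA
        have := Finset.single_le_sum (f := fun x : G =>
          ((t + (orderOf x).primeFactors.card : ℕ) : ℚ) / (orderOf x).totient)
          (s := Finset.univ.filter (fun x : G => Rough q (orderOf x))) (fun i _ => by positivity)
          (a := 1) (Finset.mem_filter.2 ⟨Finset.mem_univ _, by simp [Rough]⟩)
        simpa using this
      refine le_trans ?_ h3
      rw [h2] at h1
      exact_mod_cast h1
    · intro _ p hqp hp Q
      have : (Q : Subgroup G) = ⊥ := by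
        rw [← Subgroup.card_eq_one, Q.card_eq_multiplicity, Nat.factorization_eq_zero_of_lt, pow_zero]
        omega
      constructor
      · rw [this]; infer_instance
      · rw [this]; infer_instance
  | succ m ih =>
    intro G _ _ q t hq hlt
    classical
    by_cases hp : q.Prime
    · have : Fact q.Prime := ⟨hp⟩
      obtain ⟨k1, k2⟩ := key_lemma (G := G) q hq
      obtain ⟨i1, i2⟩ := ih G (q + 1) t (by omega) (by omega)
      have hF := ff_prime t q (Nat.card G) hp Nat.card_pos.ne'
      have hge := AA_ge t q hp G
      have hFpos : (0 : ℚ) < ff (t + 1) (q + 1) (Nat.card G) := by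
        exact_mod_cast ff_pos t (q + 1) _ Nat.card_pos.ne'
      have hsum : (ff (t + 1) (q + 1) (Nat.card G) : ℚ) *
          ∑ x : G with (x ≠ 1 ∧ ∃ i, orderOf x = q ^ i), WW q x ≤
          ∑ u : G with (u ≠ 1 ∧ ∃ i, orderOf u = q ^ i),
            1 / ((orderOf u).totient : ℚ) * AA (t + 1) (q + 1) (Subgroup.centralizer {u}) := by
        rw [Finset.mul_sum]
        apply Finset.sum_le_sum
        intro u hu
        simp only [Finset.mem_filter, Finset.mem_univ, true_and] at hu
        have hb : (ff (t + 1) (q + 1) (Nat.card G) : ℚ) ≤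
          ff (t + 1) (q + 1) (Nat.card (Subgroup.centralizer {u})) * ff 1 (q + 1) (idx u) := by
            exact_mod_cast step_bound t q hp u hu.2
        have hcl : Nat.card (Subgroup.centralizer {u}) ≤ Nat.card G :=
          Nat.le_of_dvd Nat.card_pos (Subgroup.card_subgroup_dvd_card _)
        have hA := (ih (Subgroup.centralizer {u}) (q + 1) (t + 1) (by omega) (by omega)).1
        have hφ : (0 : ℚ) < (orderOf u).totient := by
          exact_mod_cast Nat.totient_pos.2 (orderOf_pos u)
        have hf : (0 : ℚ) < ff 1 (q + 1) (idx u) := by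
          exact_mod_cast ff_pos 0 (q + 1) (idx u) Subgroup.index_ne_zero_of_finite
        unfold WW
        rw [mul_one_div, one_div_mul_eq_div, mul_comm, ← div_div]
        gcongr
        rw [div_le_iff₀ hf]
        exact hb.trans (by gcongr)
      have hF' : (ff t q (Nat.card G) : ℚ) ≤ ff t (q + 1) (Nat.card G) +
          (Nat.card G).factorization q * ff (t + 1) (q + 1) (Nat.card G) := by exact_mod_cast hF
      set S := ∑ x : G with (x ≠ 1 ∧ ∃ i, orderOf x = q ^ i), WW q x with hS
      have hm : ((Nat.card G).factorization q : ℚ) * ff (t + 1) (q + 1) (Nat.card G) ≤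
          ff (t + 1) (q + 1) (Nat.card G) * S := by
        rw [mul_comm]; gcongr
      refine ⟨by linarith, ?_⟩
      intro hle p hqp hpp Q
      rcases hqp.lt_or_eq with h | h
      · exact i2 (by linarith) p h hpp Q
      · subst h
        apply k2
        have : (ff (t + 1) (q + 1) (Nat.card G) : ℚ) * S ≤
          ff (t + 1) (q + 1) (Nat.card G) * ((Nat.card G).factorization q : ℚ) := by linarith
        exact le_of_mul_le_mul_left this hFpos
    · have hr : ∀ d, Rough q d ↔ Rough (q + 1) d := fun d =>
        ⟨fun h => h.succ_of (fun h' => hp h'.1), fun h r hr => by have := h r hr; omega⟩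
      obtain ⟨i1, i2⟩ := ih G (q + 1) t (by omega) (by omega)
      have e1 : ff t q (Nat.card G) = ff t (q + 1) (Nat.card G) := by
        unfold ff; simp only [hr]
      have e2 : AA t q G = AA t (q + 1) G := by
        unfold AA; simp only [hr]
      rw [e1, e2]
      refine ⟨i1, fun h p hqp hpp Q => i2 h p ?_ hpp Q⟩
      rcases hqp.lt_or_eq with h | h
      · exact h
      · subst h; exact absurd hpp.1 hp

theorem le_of_card_dvd {G : Type*} [Group G] [Finite G] {A B C : Subgroup G} (hC : IsCyclic C)
    (hA : A ≤ C) (hB : B ≤ C) (h : Nat.card A ∣ Nat.card B) : A ≤ B := by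
  classical
  have := Fintype.ofFinite G
  have h1 := IsCyclic.card_pow_eq_one_le (α := C) (n := Nat.card B) Nat.card_pos
  have hsub : (Finset.univ.filter (fun c : C => (c : G) ∈ B)) ⊆
      Finset.univ.filter (fun c : C => c ^ Nat.card B = 1) := by
    intro c hc
    simp only [Finset.mem_filter, Finset.mem_univ, true_and] at hc ⊢
    apply Subtype.ext
    have h3 : (c : G) ^ Nat.card B = 1 :=
      congrArg (Subtype.val) (pow_card_eq_one' (x := (⟨c, hc⟩ : B)))
    exact h3
  have hcard : (Finset.univ.filter (fun c : C => (c : G) ∈ B)).card = Nat.card B := by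
    rw [← Fintype.card_subtype, ← Nat.card_eq_fintype_card]
    exact Nat.card_congr (Subgroup.subgroupOfEquivOfLe hB).toEquiv
  have heq := Finset.eq_of_subset_of_card_le hsub (by rw [hcard]; exact h1)
  intro a ha
  have hmem : (⟨a, hA ha⟩ : C) ∈ Finset.univ.filter (fun c : C => c ^ Nat.card B = 1) := by
    simp only [Finset.mem_filter, Finset.mem_univ, true_and]
    apply Subtype.ext
    have h3 : a ^ Nat.card A = 1 :=
      congrArg (Subtype.val) (pow_card_eq_one' (x := (⟨a, ha⟩ : A)))
    obtain ⟨k, hk⟩ := h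
    change a ^ Nat.card B = 1
    rw [hk, pow_mul, h3, one_pow]
  rw [← heq] at hmem
  simpa using hmem

theorem exists_card_eq {G : Type*} [Group G] [Finite G] {C : Subgroup G} (hC : IsCyclic C)
    {d : ℕ} (hd : d ∣ Nat.card C) : ∃ B : Subgroup G, B ≤ C ∧ Nat.card B = d := by
  obtain ⟨g, hg⟩ := (Subgroup.isCyclic_iff_exists_zpowers_eq_top C).1 hC
  obtain ⟨k, hk⟩ := hd
  have hpos : 0 < Nat.card C := Nat.card_pos
  have hk0 : k ≠ 0 := by rintro rfl; omega
  refine ⟨Subgroup.zpowers (g ^ k), ?_, ?_⟩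
  · rw [← hg, Subgroup.zpowers_le]
    exact Subgroup.pow_mem _ (Subgroup.mem_zpowers g) k
  · have ho : orderOf g = d * k := by rw [← hk, ← hg, Nat.card_zpowers]
    rw [Nat.card_zpowers, orderOf_pow_of_dvd hk0 (by rw [ho]; exact Dvd.intro_left _ rfl), ho,
      Nat.mul_div_cancel _ (Nat.pos_of_ne_zero hk0)]

theorem isCyclic_le {G : Type*} [Group G] {A C : Subgroup G} (hC : IsCyclic C) (h : A ≤ C) :
    IsCyclic A :=
  isCyclic_of_injective (Subgroup.inclusion h) (Subgroup.inclusion_injective h)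

theorem eq_of_card_eq' {G : Type*} [Group G] [Finite G] {A B C : Subgroup G} (hC : IsCyclic C)
    (hA : A ≤ C) (hB : B ≤ C) (h : Nat.card A = Nat.card B) : A = B :=
  le_antisymm (le_of_card_dvd hC hA hB (dvd_of_eq h)) (le_of_card_dvd hC hB hA (dvd_of_eq h.symm))

theorem card_lt_of_lt {G : Type*} [Group G] [Finite G] {A B : Subgroup G} (h : A < B) :
    Nat.card A < Nat.card B := by
  refine lt_of_le_of_ne (Subgroup.card_le_of_le h.le) (fun he => h.ne ?_)
  exact Subgroup.eq_of_le_of_card_ge h.le he.ge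

theorem card_div_prime {G : Type*} [Group G] [Finite G] {A C : Subgroup G}
    (h : (A, C) ∈ cyclicGraphEdges G) : (Nat.card C / Nat.card A).Prime := by
  obtain ⟨h1, h2, h3, h4⟩ := h
  simp only at h1 h2 h3 h4
  obtain ⟨k, hk⟩ := Subgroup.card_dvd_of_le h3.le
  have hA0 : 0 < Nat.card A := Nat.card_pos
  have hC0 : 0 < Nat.card C := Nat.card_pos
  have hlt := card_lt_of_lt h3
  rw [hk, Nat.mul_div_cancel_left _ hA0]
  have hk1 : k ≠ 1 := by rintro rfl; omega
  obtain ⟨r, hr, j, hj⟩ := Nat.exists_prime_and_dvd hk1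
  obtain ⟨K, hK1, hK2⟩ := exists_card_eq h2 (d := Nat.card A * j)
    ⟨r, by rw [hk, hj]; ring⟩
  have hAK : A ≤ K := le_of_card_dvd h2 h3.le hK1 (by rw [hK2]; exact Dvd.intro _ rfl)
  have hj0 : 0 < j := by
    rcases Nat.eq_zero_or_pos j with rfl | h
    · simp at hj; subst hj; omega
    · exact h
  have hKC : K < C := by
    refine lt_of_le_of_ne hK1 ?_
    rintro rfl
    rw [hk, hj] at hK2
    have h5 : r * j = j := Nat.eq_of_mul_eq_mul_left hA0 hK2
    have := hr.two_le
    nlinarith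
  rcases hAK.lt_or_eq with h | h
  · exact absurd hKC (h4 K (isCyclic_le h2 hK1) h)
  · rw [← h] at hK2
    have : j = 1 := Nat.eq_of_mul_eq_mul_left hA0 (by rw [← hK2, mul_one])
    rw [hj, this, mul_one]; exact hr

open Classical in
theorem numCyclicEdges_eq (G : Type*) [Group G] [Fintype G] :
    numCyclicEdges G = ∑ U ∈ (Finset.univ : Finset (Subgroup G)).filter
      (fun U : Subgroup G => IsCyclic U), (Nat.card U).primeFactors.card := by
  unfold numCyclicEdges
  rw [Nat.card_eq_fintype_card, ← Set.toFinset_card,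
    Finset.card_eq_sum_card_fiberwise (f := Prod.snd)
      (t := (Finset.univ : Finset (Subgroup G)).filter (fun U : Subgroup G => IsCyclic U))]
  · apply Finset.sum_congr rfl
    intro C hC
    replace hC : IsCyclic C := by simpa using hC
    have hC0 : 0 < Nat.card C := Nat.card_pos
    apply Finset.card_bij (fun e _ => Nat.card C / Nat.card e.1)
    · rintro ⟨A, C'⟩ he
      simp only [Finset.mem_filter, Set.mem_toFinset] at he
      obtain ⟨he, rfl⟩ := he
      exact Nat.mem_primeFactors.2 ⟨card_div_prime he,
        Nat.div_dvd_of_dvd (Subgroup.card_dvd_of_le he.2.2.1.le), hC0.ne'⟩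
    · rintro ⟨A, C'⟩ he ⟨B, C''⟩ he' h
      simp only [Finset.mem_filter, Set.mem_toFinset] at he he'
      obtain ⟨he, rfl⟩ := he
      obtain ⟨he', rfl⟩ := he'
      have hA := he.2.2.1.le
      have hB := he'.2.2.1.le
      simp only at hA hB h
      have h1 : Nat.card A = Nat.card B :=
        (Nat.div_eq_iff_eq_of_dvd_dvd hC0.ne' (Subgroup.card_dvd_of_le hA)
          (Subgroup.card_dvd_of_le hB)).1 h
      rw [eq_of_card_eq' hC hA hB h1]
    · intro p hp
      obtain ⟨hp1, ⟨m, hm⟩, -⟩ := Nat.mem_primeFactors.1 hp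
      obtain ⟨A, hA1, hA2⟩ := exists_card_eq hC (d := m) ⟨p, by rw [hm, mul_comm]⟩
      have hm0 : 0 < m := by rw [← hA2]; exact Nat.card_pos
      refine ⟨(A, C), ?_, ?_⟩
      · simp only [Finset.mem_filter, Set.mem_toFinset, and_true]
        refine ⟨isCyclic_le hC hA1, hC, lt_of_le_of_ne hA1 ?_, ?_⟩
        · rintro h
          simp only at h
          subst h
          have := hp1.two_le
          nlinarith
        · intro K hK hAK hKC
          simp only at hAK hKC
          have l1 := card_lt_of_lt hAK
          have l2 := card_lt_of_lt hKC
          obtain ⟨a, ha⟩ := Subgroup.card_dvd_of_le hAK.le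
          obtain ⟨b, hb⟩ := Subgroup.card_dvd_of_le hKC.le
          have : p = a * b := by
            apply Nat.eq_of_mul_eq_mul_left hm0
            rw [mul_comm, ← hm, hb, ha, hA2, mul_assoc]
          rcases (Nat.dvd_prime hp1).1 (Dvd.intro b this.symm) with h | h
          · rw [h, mul_one] at ha; omega
          · subst h
            have hb1 : b = 1 := Nat.eq_of_mul_eq_mul_left hp1.pos (by rw [← this, mul_one])
            rw [hb1, mul_one] at hb; omega
      · simp only
        rw [hA2, hm, Nat.mul_div_cancel _ hm0]
  · intro e he
    have he : e ∈ cyclicGraphEdges G := by simpa using he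
    simpa using he.2.1

theorem rough_three {d : ℕ} (h : Odd d) : Rough 3 d := by
  intro p hp
  obtain ⟨h1, h2, h3⟩ := Nat.mem_primeFactors.1 hp
  rcases h1.eq_two_or_odd' with h4 | h4
  · subst h4
    exact absurd h (by rw [Nat.not_odd_iff_even]; exact even_iff_two_dvd.2 h2)
  · obtain ⟨k, rfl⟩ := h4
    have := h1.two_le
    omega

theorem numCyclicEdges_AA (G : Type*) [Group G] [Fintype G] (hodd : Odd (Nat.card G)) :
    (numCyclicEdges G : ℚ) = AA 0 3 G := by
  classical
  have h := sum_zpowers_s13 G (fun U => ((Nat.card U).primeFactors.card : ℚ) / (Nat.card U).totient)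
  rw [numCyclicEdges_eq]
  unfold AA
  rw [Finset.filter_true_of_mem (p := fun x : G => Rough 3 (orderOf x))]
  · simp only [Nat.card_zpowers] at h
    simp only [zero_add]
    rw [h]
    push_cast
    apply Finset.sum_congr rfl
    intro U _
    have : ((Nat.card U).totient : ℚ) ≠ 0 := by
      exact_mod_cast (Nat.totient_pos.2 Nat.card_pos).ne'
    field_simp
  · intro x _
    exact rough_three (hodd.of_dvd_nat (orderOf_dvd_natCard x))

theorem AA_cyclic (G : Type*) [Group G] [Fintype G] [IsCyclic G] (t q : ℕ) :
    AA t q G = ff t q (Nat.card G) := by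
  classical
  unfold AA ff
  rw [← Finset.sum_fiberwise_of_maps_to (g := fun x : G => orderOf x)
    (t := (Nat.card G).divisors.filter (Rough q))]
  · push_cast
    apply Finset.sum_congr rfl
    intro d hd
    simp only [Finset.mem_filter, Nat.mem_divisors] at hd
    obtain ⟨⟨hd1, hd2⟩, hd3⟩ := hd
    have hcard := IsCyclic.card_orderOf_eq_totient (α := G) (d := d)
      (by rw [← Nat.card_eq_fintype_card]; exact hd1)
    have hf : ({x ∈ ({x : G | Rough q (orderOf x)} : Finset G) | orderOf x = d} : Finset G) =
        ({x : G | orderOf x = d} : Finset G) := by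
      rw [Finset.filter_filter]
      apply Finset.filter_congr
      intro x _
      constructor
      · exact fun h => h.2
      · intro h; exact ⟨by rw [h]; exact hd3, h⟩
    rw [hf, Finset.sum_congr rfl (g := fun _ => ((t + d.primeFactors.card : ℕ) : ℚ) / d.totient),
      Finset.sum_const, hcard, nsmul_eq_mul]
    · have : (d.totient : ℚ) ≠ 0 := by
        exact_mod_cast (Nat.totient_pos.2 (Nat.pos_of_dvd_of_pos hd1 Nat.card_pos)).ne'
      push_cast
      field_simp
    · intro x hx
      have hx : orderOf x = d := by simpa using hx
      rw [hx]; push_cast; rfl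
  · intro x hx
    rw [Finset.mem_filter] at hx ⊢
    exact ⟨Nat.mem_divisors.2 ⟨orderOf_dvd_natCard x, Nat.card_pos.ne'⟩, hx.2⟩

theorem isCyclic_of_numCyclicEdges_eq (G : Type*) [Group G] [Finite G]
    (hodd : Odd (Nat.card G))
    (h : numCyclicEdges G = numCyclicEdges (Multiplicative (ZMod (Nat.card G)))) :
    IsCyclic G := by
  classical
  have := Fintype.ofFinite G
  have : NeZero (Nat.card G) := ⟨Nat.card_pos.ne'⟩
  have hcard : Nat.card (Multiplicative (ZMod (Nat.card G))) = Nat.card G := by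
    rw [Nat.card_congr Multiplicative.toAdd, Nat.card_zmod]
  have h1 := numCyclicEdges_AA G hodd
  have h2 := numCyclicEdges_AA (Multiplicative (ZMod (Nat.card G))) (by rw [hcard]; exact hodd)
  rw [AA_cyclic, hcard, ← h, h1] at h2
  have h3 := (main_ind (Nat.card G) G 3 0 le_rfl (by omega)).2 h2.le
  have h4 : ∀ p, Fact p.Prime → ∀ Q : Sylow p G, IsCyclic Q ∧ (Q : Subgroup G).Normal := by
    intro p hp Q
    by_cases hp3 : 3 ≤ p
    · exact h3 p hp3 hp Q
    · have hp2 : p = 2 := by have := hp.1.two_le; omega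
      have : (Q : Subgroup G) = ⊥ := by
        rw [← Subgroup.card_eq_one, Q.card_eq_multiplicity,
          Nat.factorization_eq_zero_of_not_dvd, pow_zero]
        subst hp2
        exact hodd.not_two_dvd_nat
      constructor
      · rw [this]; infer_instance
      · rw [this]; infer_instance
  have hZ : IsZGroup G := ⟨fun p hp Q => (h4 p ⟨hp⟩ Q).1⟩
  have hN : Group.IsNilpotent G :=
    ((Group.isNilpotent_of_finite_tfae (G := G)).out 0 3).2 (fun p hp Q => (h4 p hp Q).2)
  infer_instance
end

section
/- There exist non-cyclic groups G of even order n with |E(C(G)*)| = |E(C(ℤ_n)*)|: for n = 12, both the alternating group A_4 and the dicyclic group Dic_3 satisfy |E(C(G)*)| = |E(C(ℤ_12)*)| = 7. -/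
/-- the finite set of powers of `g` (all of them once `g ^ 12 = 1`). -/
def pw {G : Type*} [Group G] [DecidableEq G] (g : G) : Finset G :=
  (Finset.range 12).image (fun k => g ^ k)

theorem coe_pw {G : Type*} [Group G] [DecidableEq G] (g : G) (h : g ^ 12 = 1) :
    (pw g : Set G) = Subgroup.zpowers g := by
  ext x
  simp only [pw, Finset.coe_image, Set.mem_image, SetLike.mem_coe, Finset.mem_range]
  constructor
  · rintro ⟨k, -, rfl⟩
    exact Subgroup.npow_mem_zpowers g k
  · intro hx
    have hf : IsOfFinOrder g := isOfFinOrder_iff_pow_eq_one.2 ⟨12, by norm_num, h⟩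
    obtain ⟨k, rfl⟩ := (hf.mem_powers_iff_mem_zpowers.2 hx)
    refine ⟨k % 12, Nat.mod_lt _ (by norm_num), ?_⟩
    exact (pow_eq_pow_mod k h).symm

/-- the covering pairs of a relation on a finite index type. -/
def covs {m : ℕ} (le : Fin m → Fin m → Bool) : Finset (Fin m × Fin m) :=
  Finset.univ.filter (fun p => (le p.1 p.2 ∧ p.1 ≠ p.2) ∧
    ∀ c, (le p.1 c ∧ p.1 ≠ c) → ¬ (le c p.2 ∧ c ≠ p.2))

theorem num_eq (G : Type*) [Group G] [DecidableEq G] (h : ∀ g : G, g ^ 12 = 1)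
    {m : ℕ} (r : Fin m → G) (le : Fin m → Fin m → Bool)
    (hle : ∀ i j, le i j = true ↔ r i ∈ pw (r j))
    (hanti : ∀ i j, le i j = true → le j i = true → i = j)
    (hr : ∀ g : G, ∃ i, g ∈ pw (r i) ∧ r i ∈ pw g) :
    numCyclicEdges G = (covs le).card := by
  have hmem : ∀ a b : G, a ∈ pw b ↔ Subgroup.zpowers a ≤ Subgroup.zpowers b := by
    intro a b
    rw [Subgroup.zpowers_le, ← Finset.mem_coe, coe_pw b (h b), SetLike.mem_coe]
  let f : Fin m → Subgroup G := fun i => Subgroup.zpowers (r i)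
  have hfle : ∀ i j, le i j = true ↔ f i ≤ f j := fun i j => (hle i j).trans (hmem _ _)
  have hinj : Function.Injective f := fun i j e =>
    hanti i j ((hfle i j).2 e.le) ((hfle j i).2 e.ge)
  have hlt : ∀ i j, (le i j = true ∧ i ≠ j) ↔ f i < f j := by
    intro i j
    rw [lt_iff_le_and_ne, hfle, hinj.ne_iff]
  have hc : ∀ H : Subgroup G, IsCyclic H → ∃ i, f i = H := by
    intro H hH
    obtain ⟨g, rfl⟩ := (Subgroup.isCyclic_iff_exists_zpowers_eq_top H).1 hH
    obtain ⟨i, h1, h2⟩ := hr g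
    exact ⟨i, le_antisymm ((hmem _ _).1 h2) ((hmem _ _).1 h1)⟩
  have hcyc : ∀ i, IsCyclic (f i) := fun i => by
    change IsCyclic (Subgroup.zpowers (r i))
    infer_instance
  have himg : Prod.map f f '' (covs le : Set (Fin m × Fin m)) = cyclicGraphEdges G := by
    ext ⟨a, b⟩
    simp only [covs, hlt, Finset.coe_filter, Finset.mem_univ, true_and, Set.mem_ofPred_eq,
      Set.mem_image, cyclicGraphEdges, Prod.exists, Prod.map_apply, Prod.mk.injEq]
    constructor
    · rintro ⟨i, j, ⟨hl, hm⟩, rfl, rfl⟩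
      refine ⟨hcyc i, hcyc j, hl, ?_⟩
      intro K hK
      obtain ⟨c, rfl⟩ := hc K hK
      exact hm c
    · rintro ⟨ha, hb, hl, hm⟩
      obtain ⟨i, rfl⟩ := hc a ha
      obtain ⟨j, rfl⟩ := hc b hb
      exact ⟨i, j, ⟨hl, fun c => hm (f c) (hcyc c)⟩, rfl, rfl⟩
  rw [← Set.ncard_coe_finset, ← Set.ncard_image_of_injective _ (hinj.prodMap hinj), himg]
  rfl

/-- generators of the cyclic subgroups of `A_4`. -/
def genA : Fin 8 → alternatingGroup (Fin 4) :=
  ![1, ⟨c[0, 1] * c[2, 3], Equiv.Perm.mem_alternatingGroup.2 (by decide +kernel)⟩, ⟨c[0, 2] * c[1, 3], Equiv.Perm.mem_alternatingGroup.2 (by decide +kernel)⟩,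
    ⟨c[0, 3] * c[1, 2], Equiv.Perm.mem_alternatingGroup.2 (by decide +kernel)⟩, ⟨c[0, 1, 2], Equiv.Perm.mem_alternatingGroup.2 (by decide +kernel)⟩, ⟨c[0, 1, 3], Equiv.Perm.mem_alternatingGroup.2 (by decide +kernel)⟩,
    ⟨c[0, 2, 3], Equiv.Perm.mem_alternatingGroup.2 (by decide +kernel)⟩, ⟨c[1, 2, 3], Equiv.Perm.mem_alternatingGroup.2 (by decide +kernel)⟩]

/-- generators of the cyclic subgroups of `Dic_3`. -/
def genQ : Fin 7 → QuaternionGroup 3 :=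
  ![1, .a 3, .a 2, .a 1, .xa 0, .xa 1, .xa 2]

/-- generators of the cyclic subgroups of `ℤ/12`. -/
def genZ : Fin 6 → Multiplicative (ZMod 12) :=
  ![.ofAdd 0, .ofAdd 6, .ofAdd 4, .ofAdd 3, .ofAdd 2, .ofAdd 1]

theorem not_cyclic_of {G : Type*} [Group G] (a b : G) (h : a * b ≠ b * a) : ¬ IsCyclic G := by
  intro hc
  let _ := IsCyclic.commGroup (α := G)
  exact h (mul_comm a b)

theorem noncyclic_even_order_equality_examples :
    ¬ IsCyclic (alternatingGroup (Fin 4)) ∧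
    ¬ IsCyclic (QuaternionGroup 3) ∧
    numCyclicEdges (alternatingGroup (Fin 4)) = 7 ∧
    numCyclicEdges (QuaternionGroup 3) = 7 ∧
    numCyclicEdges (Multiplicative (ZMod 12)) = 7 := by
  refine ⟨?_, ?_, ?_, ?_, ?_⟩
  · have : ∃ a b : alternatingGroup (Fin 4), a * b ≠ b * a := by decide +kernel
    obtain ⟨a, b, h⟩ := this
    exact not_cyclic_of a b h
  · have : ∃ a b : QuaternionGroup 3, a * b ≠ b * a := by decide +kernel
    obtain ⟨a, b, h⟩ := this
    exact not_cyclic_of a b h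
  · rw [num_eq _ (by decide +kernel) genA (fun i j => i == j || i == 0)
      (by decide +kernel) (by decide +kernel) (by decide +kernel)]
    decide +kernel
  · rw [num_eq _ (by decide +kernel) genQ
      (fun i j => i == j || i == 0 || (i == 1 && 3 ≤ j) || (i == 2 && j == 3))
      (by decide +kernel) (by decide +kernel) (by decide +kernel)]
    decide +kernel
  · rw [num_eq _ (by decide +kernel) genZ
      (fun i j => (![1, 2, 3, 4, 6, 12] : Fin 6 → ℕ) j % (![1, 2, 3, 4, 6, 12] : Fin 6 → ℕ) i == 0)
      (by decide +kernel) (by decide +kernel) (by decide +kernel)]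
    decide +kernel
end
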